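/- arXiv:1209.1720 — 8 statements merged into one kernel-verified Lean document; each statement's English description precedes it below -/
import Mathlib

section
/- Let Γ be a group, A a finite cyclic normal subgroup of Γ such that the quotient B = Γ/A is also finite cyclic. Let M be a finitely generated free ℤ-module equipped with a ℤ-linear action of Γ such that the submodule of Γ-invariants M^Γ is zero. Then the coinvariants M_Γ, the Γ-invariants (M_A)^Γ of the A-coinvariants, and the Γ-coinvariants (M^A)_Γ of the A-invariants are all finite groups, and |M_Γ| = |(M_A)^Γ| · |(M^A)_Γ|. -/
/-- The additive subgroup of `M` generated by the elements `g • m - m` for `g` in the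
subgroup `H` of `Γ`; the quotient `M ⧸ coinvKer Γ M H` is the module of `H`-coinvariants. -/
def coinvKer (Γ : Type*) [Group Γ] (M : Type*) [AddCommGroup M] [DistribMulAction Γ M]
    (H : Subgroup Γ) : AddSubgroup M :=
  AddSubgroup.closure {x : M | ∃ g ∈ H, ∃ m : M, x = g • m - m}

/-- The additive subgroup of `H`-invariants of `M`. -/
def invSub (Γ : Type*) [Group Γ] (M : Type*) [AddCommGroup M] [DistribMulAction Γ M]
    (H : Subgroup Γ) : AddSubgroup M where
  carrier := {m : M | ∀ g ∈ H, g • m = m}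
  add_mem' := by
    intro a b ha hb g hg
    rw [smul_add, ha g hg, hb g hg]
  zero_mem' := by
    intro g hg
    exact smul_zero g
  neg_mem' := by
    intro a ha g hg
    rw [smul_neg, ha g hg]

/-- The subgroup of `N` by which one divides to form the `Γ`-coinvariants of `N`:
it is generated by the elements `g • m - m` with `g ∈ Γ` and `m ∈ N`. -/
def relCoinvKer (Γ : Type*) [Group Γ] (M : Type*) [AddCommGroup M] [DistribMulAction Γ M]
    (N : AddSubgroup M) : AddSubgroup ↥N :=
  (AddSubgroup.closure {x : M | ∃ g : Γ, ∃ m ∈ N, x = g • m - m}).addSubgroupOf N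

theorem index_aux {N L : Type*} [AddCommGroup N] [AddCommGroup L] (φ : N →+ L) (T : N →+ N) (S : L →+ L)
    (h : ∀ x, φ (T x) = S (φ x)) (hS : Function.Injective S) [Finite φ.ker]
    (hφ : φ.range.index ≠ 0) (hSi : S.range.index ≠ 0) :
    Finite T.ker ∧ T.range.index ≠ 0 ∧ T.range.index = Nat.card T.ker * S.range.index := by
  have hle : T.ker ≤ φ.ker := by
    intro x hx
    rw [AddMonoidHom.mem_ker] at *
    apply hS
    rw [← h, hx]; simp
  have hfin : Finite T.ker := Finite.of_injective _ (AddSubgroup.inclusion_injective hle)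
  have e1 : (T.range ⊔ φ.ker).index * φ.range.index = φ.range.index * S.range.index := by
    have h1 := AddSubgroup.index_map T.range φ
    have h2 := AddSubgroup.index_map φ.range S
    rw [(AddMonoidHom.ker_eq_bot_iff S).2 hS, sup_bot_eq] at h2
    rw [← h1, ← h2, AddMonoidHom.map_range, AddMonoidHom.map_range]
    congr 2
    ext x; exact h x
  have e2 : (T.range ⊔ φ.ker).index = S.range.index := by
    rw [mul_comm] at e1
    exact Nat.eq_of_mul_eq_mul_left (Nat.pos_of_ne_zero hφ) e1
  have e3 := AddSubgroup.relIndex_mul_index (le_sup_left : T.range ≤ T.range ⊔ φ.ker)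
  rw [AddSubgroup.relIndex_sup_left] at e3
  have e4 : φ.ker.map T = T.range ⊓ φ.ker := by
    ext y
    constructor
    · rintro ⟨x, hx, rfl⟩
      refine ⟨⟨x, rfl⟩, ?_⟩
      have hx' : φ x = 0 := hx
      show φ (T x) = 0
      rw [h, hx', map_zero]
    · rintro ⟨⟨x, rfl⟩, hy⟩
      refine ⟨x, ?_, rfl⟩
      have hy' : φ (T x) = 0 := hy
      show φ x = 0
      apply hS
      rw [← h, hy', map_zero]
  have e5 : Nat.card T.ker * Nat.card (φ.ker.map T) = Nat.card φ.ker := by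
    have a1 := AddSubgroup.relIndex_ker φ.ker T 
    have a2 := AddSubgroup.relIndex_mul_relIndex ⊥ T.ker φ.ker bot_le hle
    rw [AddSubgroup.relIndex_bot_left, AddSubgroup.relIndex_bot_left, a1] at a2
    exact a2
  have e6 : Nat.card (φ.ker.map T) * T.range.relIndex φ.ker = Nat.card φ.ker := by
    have a2 := AddSubgroup.relIndex_mul_relIndex ⊥ (T.range ⊓ φ.ker) φ.ker bot_le inf_le_right
    rw [AddSubgroup.relIndex_bot_left, AddSubgroup.relIndex_bot_left, AddSubgroup.inf_relIndex_right] at a2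
    rw [e4]; exact a2
  have p : 0 < Nat.card φ.ker := Nat.card_pos
  have e7 : T.range.relIndex φ.ker = Nat.card T.ker := by
    have : 0 < Nat.card (φ.ker.map T) := by
      rcases Nat.eq_zero_or_pos (Nat.card (φ.ker.map T)) with h0 | h0
      · rw [h0] at e5; omega
      · exact h0
    apply Nat.eq_of_mul_eq_mul_left this
    rw [e6, ← e5, mul_comm]
  have e8 : T.range.index = Nat.card T.ker * S.range.index := by
    rw [← e3, e7, e2]
  refine ⟨hfin, ?_, e8⟩
  rw [e8]
  exact mul_ne_zero Nat.card_pos.ne' hSi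

theorem finite_aux {N : Type*} [AddCommGroup N] [Module.Finite ℤ N] (n : ℕ) (hn : n ≠ 0)
    (h : ∀ x : N, n • x = 0) : Finite N := by
  apply Module.finite_of_fg_torsion
  intro x
  refine ⟨⟨(n : ℤ), mem_nonZeroDivisors_of_ne_zero (by exact_mod_cast hn)⟩, ?_⟩
  show (n : ℤ) • x = 0
  rw [natCast_zsmul, h]

theorem inj_aux {L : Type*} [AddCommGroup L] [Module.Finite ℤ L] [Module.Free ℤ L] (S : L →+ L)
    (hS : Function.Injective S) : S.range.index ≠ 0 := by
  have := Submodule.finiteQuotientOfFreeOfRankEq (LinearMap.range S.toIntLinearMap)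
    (LinearMap.finrank_range_of_inj (f := S.toIntLinearMap) hS)
  have e : (LinearMap.range S.toIntLinearMap).toAddSubgroup = S.range := by
    ext x; rfl
  rw [← e]
  have : Finite (L ⧸ (LinearMap.range S.toIntLinearMap).toAddSubgroup) := this
  exact AddSubgroup.index_ne_zero_of_finite

theorem gen_aux {Γ : Type*} [Group Γ] (A : Subgroup Γ) [A.Normal] (b : Γ)
    (hb : ∀ x : Γ ⧸ A, x ∈ Subgroup.zpowers (b : Γ ⧸ A)) (H : Subgroup Γ) (hA : A ≤ H) (hbH : b ∈ H) (g : Γ) :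
    g ∈ H := by
  obtain ⟨k, hk⟩ := hb g
  have hk' : ((b ^ k : Γ) : Γ ⧸ A) = g := hk
  rw [QuotientGroup.eq] at hk'
  have := H.mul_mem (H.zpow_mem hbH k) (hA hk')
  simpa using this

/-- elements moving `P` only modulo `R` -/
def moveSub (Γ : Type*) [Group Γ] (M : Type*) [AddCommGroup M] [DistribMulAction Γ M]
    (P R : AddSubgroup M) (hP : ∀ (g : Γ), ∀ m ∈ P, g • m ∈ P) : Subgroup Γ where
  carrier := {g | ∀ m ∈ P, g • m - m ∈ R}
  one_mem' := by intro m _; simp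
  mul_mem' := by
    intro g h hg hh m hm
    have := R.add_mem (hg (h • m) (hP h m hm)) (hh m hm)
    simpa [mul_smul] using this
  inv_mem' := by
    intro g hg m hm
    have := R.neg_mem (hg (g⁻¹ • m) (hP g⁻¹ m hm))
    simpa using this

/-- elements fixing `m` modulo `R` -/
def stabSub (Γ : Type*) [Group Γ] (M : Type*) [AddCommGroup M] [DistribMulAction Γ M]
    (R : AddSubgroup M) (hR : ∀ (g : Γ), ∀ m ∈ R, g • m ∈ R) (m : M) : Subgroup Γ where
  carrier := {g | g • m - m ∈ R}
  one_mem' := by simp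
  mul_mem' := by
    intro g h hg hh
    have := R.add_mem (hR g _ hh) hg
    simpa [mul_smul, smul_sub] using this
  inv_mem' := by
    intro g hg
    have := R.neg_mem (hR g⁻¹ _ hg)
    simpa [smul_sub] using this

section aux
variable {Γ : Type*} [Group Γ] {M : Type*} [AddCommGroup M] [DistribMulAction Γ M]

theorem coinvKer_stable (A : Subgroup Γ) [hA : A.Normal] (g : Γ) (m : M) (hm : m ∈ coinvKer Γ M A) :
    g • m ∈ coinvKer Γ M A := by
  have : coinvKer Γ M A ≤ (coinvKer Γ M A).comap (DistribSMul.toAddMonoidHom M g) := by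
    conv_lhs => unfold coinvKer
    rw [AddSubgroup.closure_le]
    rintro x ⟨a, ha, m, rfl⟩
    apply AddSubgroup.subset_closure
    refine ⟨g * a * g⁻¹, hA.conj_mem a ha g, g • m, ?_⟩
    simp [smul_sub, mul_smul]
  exact this hm

theorem invSub_stable (A : Subgroup Γ) [hA : A.Normal] (g : Γ) (m : M) (hm : m ∈ invSub Γ M A) :
    g • m ∈ invSub Γ M A := by
  intro a ha
  have h1 := hm (g⁻¹ * a * g) (by simpa using hA.conj_mem a ha g⁻¹)
  calc a • g • m = g • ((g⁻¹ * a * g) • m) := by simp [smul_smul, mul_assoc]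
    _ = g • m := by rw [h1]

/-- the map `b - 1` on `M` -/
def diffM (M : Type*) [AddCommGroup M] [DistribMulAction Γ M] (b : Γ) : M →+ M :=
  DistribSMul.toAddMonoidHom M b - AddMonoidHom.id M

theorem diffM_apply (b : Γ) (m : M) : diffM M b m = b • m - m := rfl

/-- `b - 1` on the coinvariants -/
def diffN (M : Type*) [AddCommGroup M] [DistribMulAction Γ M] (A : Subgroup Γ) [A.Normal] (b : Γ) :
    M ⧸ coinvKer Γ M A →+ M ⧸ coinvKer Γ M A :=
  QuotientAddGroup.map _ _ (diffM M b) (fun m hm =>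
    (coinvKer Γ M A).sub_mem (coinvKer_stable A b m hm) hm)

/-- `b - 1` on the invariants -/
def diffL (M : Type*) [AddCommGroup M] [DistribMulAction Γ M] (A : Subgroup Γ) [A.Normal] (b : Γ) :
    invSub Γ M A →+ invSub Γ M A :=
  ((diffM M b).comp (invSub Γ M A).subtype).codRestrict (invSub Γ M A) (fun m =>
    (invSub Γ M A).sub_mem (invSub_stable A b (m : M) m.2) m.2)

/-- the norm map to the invariants -/
def normL (M : Type*) [AddCommGroup M] [DistribMulAction Γ M] (A : Subgroup Γ) [Fintype A] :
    M →+ invSub Γ M A :=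
  (∑ a : A, DistribSMul.toAddMonoidHom M (a : Γ)).codRestrict (invSub Γ M A) (by
    intro m g hg
    simp only [AddMonoidHom.finsetSum_apply, DistribSMul.toAddMonoidHom_apply, Finset.smul_sum,
      smul_smul]
    exact Fintype.sum_equiv (Equiv.mulLeft (⟨g, hg⟩ : A)) _ _ (fun x => rfl))

theorem normL_apply (A : Subgroup Γ) [Fintype A] (m : M) :
    (normL M A m : M) = ∑ a : A, (a : Γ) • m := by
  show (∑ a : A, DistribSMul.toAddMonoidHom M (a : Γ)) m = _
  simp [AddMonoidHom.finsetSum_apply]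

theorem normL_smul (A : Subgroup Γ) [A.Normal] [Fintype A] (b : Γ) (m : M) :
    (normL M A (b • m) : M) = b • (normL M A m : M) := by
  rw [normL_apply, normL_apply, Finset.smul_sum]
  refine Fintype.sum_equiv (MulAut.conjNormal b⁻¹ : MulAut A).toEquiv _ _ (fun x => ?_)
  simp [smul_smul, mul_assoc]

theorem normL_ker (A : Subgroup Γ) [Fintype A] : coinvKer Γ M A ≤ (normL M A).ker := by
  unfold coinvKer
  rw [AddSubgroup.closure_le]
  rintro x ⟨g, hg, m, rfl⟩
  show normL M A _ = 0
  rw [map_sub, sub_eq_zero]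
  apply Subtype.ext
  rw [normL_apply, normL_apply]
  exact Fintype.sum_equiv (Equiv.mulRight (⟨g, hg⟩ : A)) _ _ (fun x => by simp [smul_smul])

/-- the norm map from coinvariants to invariants -/
def normN (M : Type*) [AddCommGroup M] [DistribMulAction Γ M] (A : Subgroup Γ) [Fintype A] :
    M ⧸ coinvKer Γ M A →+ invSub Γ M A :=
  QuotientAddGroup.lift _ (normL M A) (normL_ker A)

end aux

/-- Let `Γ` be a group, `A` a finite cyclic normal subgroup with finite cyclic quotient
`Γ ⧸ A`, and `M` a finitely generated free `ℤ`-module with a `ℤ`-linear `Γ`-action whose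
`Γ`-invariants vanish.  Then the coinvariants `M_Γ`, the `Γ`-invariants of the
`A`-coinvariants, and the `Γ`-coinvariants of the `A`-invariants are all finite, and
`|M_Γ| = |(M_A)^Γ| ⬝ |(M^A)_Γ|`. -/
theorem epipelagic_stmt0 (Γ : Type*) [Group Γ] (A : Subgroup Γ) [A.Normal]
    [Finite A] [IsCyclic A] [Finite (Γ ⧸ A)] [IsCyclic (Γ ⧸ A)]
    (M : Type*) [AddCommGroup M] [Module ℤ M] [Module.Free ℤ M] [Module.Finite ℤ M]
    [DistribMulAction Γ M]
    (hinv : invSub Γ M ⊤ = ⊥) :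
    Finite (M ⧸ coinvKer Γ M ⊤) ∧
    Finite {x : M ⧸ coinvKer Γ M A //
      ∀ (g : Γ) (m : M), (QuotientAddGroup.mk m : M ⧸ coinvKer Γ M A) = x →
        (QuotientAddGroup.mk (g • m) : M ⧸ coinvKer Γ M A) = x} ∧
    Finite (↥(invSub Γ M A) ⧸ relCoinvKer Γ M (invSub Γ M A)) ∧
    Nat.card (M ⧸ coinvKer Γ M ⊤) =
      Nat.card {x : M ⧸ coinvKer Γ M A //
        ∀ (g : Γ) (m : M), (QuotientAddGroup.mk m : M ⧸ coinvKer Γ M A) = x →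
          (QuotientAddGroup.mk (g • m) : M ⧸ coinvKer Γ M A) = x} *
      Nat.card (↥(invSub Γ M A) ⧸ relCoinvKer Γ M (invSub Γ M A)) := by
  classical
  obtain rfl : ‹Module ℤ M› = AddCommGroup.toIntModule M := Subsingleton.elim _ _
  have : Fintype A := Fintype.ofFinite A
  obtain ⟨b', hb'⟩ := IsCyclic.exists_generator (α := Γ ⧸ A)
  obtain ⟨b, rfl⟩ := QuotientGroup.mk_surjective b'
  have : Module.Finite ℤ (M ⧸ coinvKer Γ M A) :=
    Module.Finite.of_surjective (QuotientAddGroup.mk' (coinvKer Γ M A)).toIntLinearMap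
      (QuotientAddGroup.mk'_surjective _)
  have : Module.Finite ℤ (invSub Γ M A) :=
    inferInstanceAs (Module.Finite ℤ (AddSubgroup.toIntSubmodule (invSub Γ M A)))
  have : Module.Free ℤ (invSub Γ M A) :=
    inferInstanceAs (Module.Free ℤ (AddSubgroup.toIntSubmodule (invSub Γ M A)))
  have hc0 : Fintype.card A ≠ 0 := Fintype.card_ne_zero
  have : Module.Finite ℤ (normN M A).ker :=
    inferInstanceAs (Module.Finite ℤ (AddSubgroup.toIntSubmodule (normN M A).ker))
  have hK : Finite (normN M A).ker := by
    apply finite_aux (Fintype.card A) hc0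
    rintro ⟨x, hx⟩
    apply Subtype.ext
    obtain ⟨m, rfl⟩ := QuotientAddGroup.mk_surjective x
    have hm : normL M A m = 0 := hx
    show Fintype.card A • (QuotientAddGroup.mk m : M ⧸ coinvKer Γ M A) = 0
    rw [← QuotientAddGroup.mk_nsmul, QuotientAddGroup.eq_zero_iff]
    have h1 : Fintype.card A • m = - ∑ a : A, ((a : Γ) • m - m) := by
      rw [Finset.sum_sub_distrib, ← normL_apply, hm]
      simp
    rw [h1]
    exact AddSubgroup.neg_mem _ (AddSubgroup.sum_mem _ fun a _ =>
      AddSubgroup.subset_closure ⟨a, a.2, m, rfl⟩)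
  have hφ : (normN M A).range.index ≠ 0 := by
    have : Module.Finite ℤ (invSub Γ M A ⧸ (normN M A).range) :=
      Module.Finite.of_surjective (QuotientAddGroup.mk' (normN M A).range).toIntLinearMap
        (QuotientAddGroup.mk'_surjective _)
    have : Finite (invSub Γ M A ⧸ (normN M A).range) := by
      apply finite_aux (Fintype.card A) hc0
      intro x
      obtain ⟨l, rfl⟩ := QuotientAddGroup.mk_surjective x
      rw [← QuotientAddGroup.mk_nsmul, QuotientAddGroup.eq_zero_iff]
      refine ⟨QuotientAddGroup.mk (l : M), ?_⟩
      show normL M A l = _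
      apply Subtype.ext
      rw [normL_apply, Finset.sum_congr rfl (fun (a : A) _ => l.2 (a : Γ) a.2)]
      simp
    exact AddSubgroup.index_ne_zero_of_finite
  have hcomm : ∀ x, normN M A (diffN M A b x) = diffL M A b (normN M A x) := by
    intro x
    obtain ⟨m, rfl⟩ := QuotientAddGroup.mk_surjective x
    show normL M A (b • m - m) = diffL M A b (normL M A m)
    apply Subtype.ext
    rw [map_sub]
    show (normL M A (b • m) : M) - normL M A m = b • (normL M A m : M) - normL M A m
    rw [normL_smul]
  have hS : Function.Injective (diffL M A b) := by
    rw [injective_iff_map_eq_zero]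
    intro l hl
    have hl' : b • (l : M) - l = 0 := congrArg Subtype.val hl
    have hb : (l : M) ∈ invSub Γ M ⊤ := by
      intro g _
      have := gen_aux A b hb' (stabSub Γ M ⊥ (by intro g m hm; simp_all) (l : M))
        (by intro a ha; show a • (l : M) - l = 0; rw [l.2 a ha, sub_self]) hl' g
      exact sub_eq_zero.1 this
    rw [hinv] at hb
    exact Subtype.ext hb
  obtain ⟨f1, f2, f3⟩ := index_aux _ _ _ hcomm hS hφ (inj_aux _ hS)
  have i1 : (coinvKer Γ M ⊤) = (diffN M A b).range.comap (QuotientAddGroup.mk' (coinvKer Γ M A)) := by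
    apply le_antisymm
    · conv_lhs => unfold coinvKer
      rw [AddSubgroup.closure_le]
      rintro x ⟨g, -, m, rfl⟩
      refine gen_aux A b hb' (moveSub Γ M ⊤ _ (by simp)) ?_ ?_ g m trivial
      · intro a ha m _
        have : (QuotientAddGroup.mk' (coinvKer Γ M A)) (a • m - m) = 0 :=
          (QuotientAddGroup.eq_zero_iff _).2 (AddSubgroup.subset_closure ⟨a, ha, m, rfl⟩)
        rw [AddSubgroup.mem_comap, this]
        exact AddSubgroup.zero_mem _
      · intro m _
        exact ⟨QuotientAddGroup.mk m, rfl⟩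
    · rintro x ⟨y, hy⟩
      obtain ⟨m, rfl⟩ := QuotientAddGroup.mk_surjective y
      have hy' : (QuotientAddGroup.mk (b • m - m) : M ⧸ coinvKer Γ M A) = QuotientAddGroup.mk x := hy
      rw [QuotientAddGroup.eq] at hy'
      have hle : coinvKer Γ M A ≤ coinvKer Γ M ⊤ :=
        AddSubgroup.closure_mono (by rintro x ⟨g, -, m, rfl⟩; exact ⟨g, trivial, m, rfl⟩)
      have h2 : b • m - m ∈ coinvKer Γ M ⊤ := AddSubgroup.subset_closure ⟨b, trivial, m, rfl⟩
      have := AddSubgroup.add_mem _ h2 (hle hy')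
      rwa [add_neg_cancel_left] at this
  have i1' : (coinvKer Γ M ⊤).index = (diffN M A b).range.index := by
    rw [i1]
    exact AddSubgroup.index_comap_of_surjective _ (QuotientAddGroup.mk'_surjective _)
  have i2 : relCoinvKer Γ M (invSub Γ M A) = (diffL M A b).range := by
    apply le_antisymm
    · have h3 : AddSubgroup.closure {x : M | ∃ g : Γ, ∃ m ∈ invSub Γ M A, x = g • m - m} ≤
          (diffL M A b).range.map (invSub Γ M A).subtype := by
        rw [AddSubgroup.closure_le]
        rintro x ⟨g, m, hm, rfl⟩
        refine gen_aux A b hb' (moveSub Γ M (invSub Γ M A) _ (invSub_stable A)) ?_ ?_ g m hm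
        · intro a ha m hm
          rw [hm a ha, sub_self]
          exact AddSubgroup.zero_mem _
        · intro m hm
          exact ⟨_, ⟨⟨m, hm⟩, rfl⟩, rfl⟩
      intro x hx
      obtain ⟨y, hy, hxy⟩ := h3 hx
      rwa [← Subtype.ext hxy]
    · rintro _ ⟨y, rfl⟩
      exact AddSubgroup.subset_closure ⟨b, y, y.2, rfl⟩
  have i3 : ∀ x : M ⧸ coinvKer Γ M A, (∀ (g : Γ) (m : M), (QuotientAddGroup.mk m : M ⧸ coinvKer Γ M A) = x →
      (QuotientAddGroup.mk (g • m) : M ⧸ coinvKer Γ M A) = x) ↔ x ∈ (diffN M A b).ker := by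
    intro x
    constructor
    · intro h
      obtain ⟨m, rfl⟩ := QuotientAddGroup.mk_surjective x
      show (QuotientAddGroup.mk (b • m - m) : M ⧸ coinvKer Γ M A) = 0
      rw [QuotientAddGroup.mk_sub, h b m rfl, sub_self]
    · rintro hx g m rfl
      have hx' : (QuotientAddGroup.mk (b • m - m) : M ⧸ coinvKer Γ M A) = 0 := hx
      rw [QuotientAddGroup.eq_zero_iff] at hx'
      have : g • m - m ∈ coinvKer Γ M A :=
        gen_aux A b hb' (stabSub Γ M _ (coinvKer_stable A) m)
          (fun a ha => AddSubgroup.subset_closure ⟨a, ha, m, rfl⟩) hx' g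
      rw [← sub_eq_zero, ← QuotientAddGroup.mk_sub, QuotientAddGroup.eq_zero_iff]
      exact this
  have e := Equiv.subtypeEquivRight i3
  refine ⟨?_, ?_, ?_, ?_⟩
  · have : (coinvKer Γ M ⊤).FiniteIndex := ⟨by rwa [i1']⟩
    exact AddSubgroup.finite_quotient_of_finiteIndex
  · exact Finite.of_equiv _ e.symm
  · rw [i2]
    have : (diffL M A b).range.FiniteIndex := ⟨inj_aux _ hS⟩
    exact AddSubgroup.finite_quotient_of_finiteIndex
  · rw [Nat.card_congr e, i2]
    show (coinvKer Γ M ⊤).index = Nat.card (diffN M A b).ker * (diffL M A b).range.index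
    rw [i1', f3]
end

section
/- Fix n ≥ 2. For each index i with 0 ≤ i ≤ n−2 let N_i be the n×n complex matrix that agrees with the identity matrix except in rows and columns i and i+1, where its entries are N_i[i,i+1] = 1, N_i[i+1,i] = −1, and N_i[i,i] = N_i[i+1,i+1] = 0. For a permutation σ of {0,…,n−1}, let inv(σ) = #{(i,j) : i < j and σ⁻¹(i) > σ⁻¹(j)}, and for each j let c_j = #{i : i < j and σ⁻¹(i) > σ⁻¹(j)}. Then for every list of indices i_1,…,i_k such that σ = s_{i_1}∘⋯∘s_{i_k} (where s_i denotes the transposition of i and i+1, and composition is composition of functions) and such that k = inv(σ) (a reduced word), the matrix product N_{i_1}·N_{i_2}·⋯·N_{i_k} is the matrix whose (a,b) entry is zero unless a = σ(b), and whose (σ(b), b) entry equals (−1)^{c_{σ(b)}}. -/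
/-- For `0 ≤ i ≤ n-2` (with `n = m+2`), the `n × n` complex matrix which agrees with the
identity except in rows and columns `i` and `i+1`, where its entries are
`N[i, i+1] = 1`, `N[i+1, i] = -1` and `N[i, i] = N[i+1, i+1] = 0`.
(This is the Springer lift of the simple reflection `s_i` in `GL_n(ℂ)`.) -/
def springerN (m : ℕ) (i : Fin (m + 1)) : Matrix (Fin (m + 2)) (Fin (m + 2)) ℂ :=
  Matrix.of fun a b =>
    if a = i.castSucc ∧ b = i.succ then 1
    else if a = i.succ ∧ b = i.castSucc then -1
    else if a = b ∧ a ≠ i.castSucc ∧ a ≠ i.succ then 1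
    else 0

/-- inversions ending at `j` -/
def invC {n : ℕ} (τ : Equiv.Perm (Fin n)) (j : Fin n) : ℕ :=
  (Finset.univ.filter fun k : Fin n => k < j ∧ τ⁻¹ j < τ⁻¹ k).card

lemma inv_eq_sum {n : ℕ} (τ : Equiv.Perm (Fin n)) :
    (Finset.univ.filter fun p : Fin n × Fin n => p.1 < p.2 ∧ τ⁻¹ p.2 < τ⁻¹ p.1).card
      = ∑ j, invC τ j := by
  simp only [invC, Finset.card_filter]
  rw [Fintype.sum_prod_type_right]

lemma swap_val {m : ℕ} (i : Fin (m + 1)) (j : Fin (m + 2)) :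
    ((Equiv.swap i.castSucc i.succ j : Fin (m + 2)) : ℕ) =
      if (j : ℕ) = i then (i : ℕ) + 1 else if (j : ℕ) = i + 1 then (i : ℕ) else j := by
  rw [Equiv.swap_apply_def]
  simp only [Fin.ext_iff, Fin.val_castSucc, Fin.val_succ]
  split_ifs <;> simp

lemma invC_swap {m : ℕ} (τ : Equiv.Perm (Fin (m + 2))) (i : Fin (m + 1))
    (h : τ⁻¹ i.castSucc < τ⁻¹ i.succ) (j : Fin (m + 2)) :
    invC (Equiv.swap i.castSucc i.succ * τ) j =
      invC τ (Equiv.swap i.castSucc i.succ j) + if j = i.succ then 1 else 0 := by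
  have key : invC (Equiv.swap i.castSucc i.succ * τ) j =
      (Finset.univ.filter fun k : Fin (m + 2) => Equiv.swap i.castSucc i.succ k < j ∧
        τ⁻¹ (Equiv.swap i.castSucc i.succ j) < τ⁻¹ k).card := by
    unfold invC
    refine Finset.card_equiv (Equiv.swap i.castSucc i.succ) ?_
    intro k
    simp [mul_inv_rev]
  rw [key]
  unfold invC
  by_cases hj : j = i.succ
  · subst hj
    simp only [Equiv.swap_apply_right, if_true]
    rw [← Finset.card_insert_of_notMem (a := i.succ)]
    · congr 1
      ext k
      have := swap_val i k
      simp only [Finset.mem_filter, Finset.mem_univ, true_and, Finset.mem_insert]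
      by_cases hk : k = i.succ
      · subst hk
        simpa using h
      · simp only [hk, false_or]
        refine and_congr_left fun _ => ?_
        simp only [Fin.lt_def, Fin.ext_iff, Fin.val_castSucc, Fin.val_succ, this] at *
        split_ifs <;> omega
    · simp only [Finset.mem_filter, Finset.mem_univ, true_and, Fin.lt_def, Fin.val_castSucc,
        Fin.val_succ]
      omega
  · simp only [hj, if_false, add_zero]
    congr 1
    ext k
    simp only [Finset.mem_filter, Finset.mem_univ, true_and]
    refine and_congr_left fun hlt => ?_
    have h1 := swap_val i k
    have h2 := swap_val i j
    by_cases hj' : j = i.castSucc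
    · subst hj'
      have hk : k ≠ i.castSucc := by
        rintro rfl
        simp only [Equiv.swap_apply_left] at hlt
        exact absurd h (not_lt.mpr hlt.le)
      simp only [Fin.lt_def, Fin.ext_iff, Fin.val_castSucc, Fin.val_succ, h1, h2, ne_eq] at hj hk ⊢
      split_ifs <;> omega
    · simp only [Fin.lt_def, Fin.ext_iff, Fin.val_castSucc, Fin.val_succ, h1, h2] at hj hj' ⊢
      split_ifs <;> omega

lemma sum_invC_swap {m : ℕ} (τ : Equiv.Perm (Fin (m + 2))) (i : Fin (m + 1))
    (h : τ⁻¹ i.castSucc < τ⁻¹ i.succ) :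
    ∑ j : Fin (m + 2), invC (n := m + 2) (Equiv.swap i.castSucc i.succ * τ) j = ∑ j, invC τ j + 1 := by
  simp only [invC_swap τ i h, Finset.sum_add_distrib]
  rw [Equiv.sum_comp (Equiv.swap i.castSucc i.succ) (invC τ)]
  simp

lemma sum_invC_swap' {m : ℕ} (τ : Equiv.Perm (Fin (m + 2))) (i : Fin (m + 1))
    (h : ¬ τ⁻¹ i.castSucc < τ⁻¹ i.succ) :
    ∑ j, invC τ j = ∑ j : Fin (m + 2), invC (n := m + 2) (Equiv.swap i.castSucc i.succ * τ) j + 1 := by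
  have hne : τ⁻¹ i.succ ≠ τ⁻¹ i.castSucc := by
    intro hh
    have := τ⁻¹.injective hh
    simp [Fin.ext_iff] at this
  have := sum_invC_swap (Equiv.swap i.castSucc i.succ * τ) i (by
    simpa [mul_inv_rev] using lt_of_le_of_ne (not_lt.mp h) hne)
  rw [← this, ← mul_assoc, Equiv.swap_mul_self, one_mul]

/-- the permutation of a word -/
def wd {m : ℕ} (l : List (Fin (m + 1))) : Equiv.Perm (Fin (m + 2)) :=
  (l.map fun i => Equiv.swap i.castSucc i.succ).prod

lemma wd_nil {m : ℕ} : wd ([] : List (Fin (m + 1))) = 1 := rfl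

lemma wd_cons {m : ℕ} (i : Fin (m + 1)) (l : List (Fin (m + 1))) :
    wd (i :: l) = Equiv.swap i.castSucc i.succ * wd l := by
  simp [wd]

lemma sum_invC_le {m : ℕ} (l : List (Fin (m + 1))) :
    ∑ j, invC (wd l) j ≤ l.length := by
  induction l with
  | nil =>
    simp only [wd_nil, List.length_nil, nonpos_iff_eq_zero,
      Finset.sum_eq_zero_iff]
    intro j _
    simp only [invC, Finset.card_eq_zero, Finset.filter_eq_empty_iff, inv_one,
      Equiv.Perm.one_apply]
    intro k _ hk
    exact lt_asymm hk.1 hk.2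
  | cons i l ih =>
    simp only [wd_cons, List.length_cons]
    by_cases h : ((wd l))⁻¹ i.castSucc <
      ((wd l))⁻¹ i.succ
    · rw [sum_invC_swap _ i h]; omega
    · have := sum_invC_swap' _ i h
      change ∑ j : Fin (m + 2), invC (n := m + 2) (Equiv.swap i.castSucc i.succ * wd l) j ≤ _
      omega

lemma springerN_apply (m : ℕ) (i : Fin (m + 1)) (a b : Fin (m + 2)) :
    springerN m i a b = if a = Equiv.swap i.castSucc i.succ b then
      (if a = i.succ then -1 else 1) else 0 := by
  have h := swap_val i b
  simp only [springerN, Matrix.of_apply, Fin.ext_iff, Fin.val_castSucc, Fin.val_succ, h, ne_eq]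
  split_ifs <;> first | rfl | omega

lemma main_aux (m : ℕ) (l : List (Fin (m + 1)))
    (hl : l.length = ∑ j, invC (wd l) j)
    (a b : Fin (m + 2)) :
    (l.map (springerN m)).prod a b =
      if a = (wd l) b then
        (-1 : ℂ) ^ invC (wd l) a else 0 := by
  induction l generalizing a b with
  | nil =>
    have h0 : invC (1 : Equiv.Perm (Fin (m + 2))) a = 0 := by
      simp only [invC, Finset.card_eq_zero, Finset.filter_eq_empty_iff, inv_one,
        Equiv.Perm.one_apply]
      intro k _ hk
      exact lt_asymm hk.1 hk.2
    simp [wd_nil, h0, Matrix.one_apply]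
  | cons i l ih =>
    have hle := sum_invC_le l
    simp only [wd_cons, List.map_cons, List.prod_cons, List.length_cons] at hl ⊢
    generalize wd l = τ at *
    by_cases h : τ⁻¹ i.castSucc < τ⁻¹ i.succ
    · rw [sum_invC_swap _ i h] at hl
      have ih' := ih (by omega)
      rw [Matrix.mul_apply]
      simp only [ih', springerN_apply, mul_ite, mul_zero, Finset.sum_ite_eq', Finset.mem_univ,
        if_true]
      by_cases hab : a = Equiv.swap i.castSucc i.succ (τ b)
      · rw [if_pos hab, if_pos (show a = (Equiv.swap i.castSucc i.succ * τ) b from hab), invC_swap τ i h a]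
        have : Equiv.swap i.castSucc i.succ a = τ b := by rw [hab, Equiv.swap_apply_self]
        rw [this]
        split_ifs <;> simp [pow_succ]
      · rw [if_neg hab, if_neg (show ¬ a = (Equiv.swap i.castSucc i.succ * τ) b from hab), zero_mul]
    · have := sum_invC_swap' _ i h
      change _ = ∑ j : Fin (m + 2), invC (n := m + 2) (Equiv.swap i.castSucc i.succ * τ) j at hl
      omega

/-- For a permutation `σ` of `{0, …, n-1}` and a reduced word `σ = s_{i₁} ∘ ⋯ ∘ s_{i_k}`
(so `k = inv(σ) = #{(i,j) : i < j, σ⁻¹ i > σ⁻¹ j}`), the product `N_{i₁} ⋯ N_{i_k}` of the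
Springer lift matrices is the matrix whose `(a, b)` entry vanishes unless `a = σ b`, and
whose `(σ b, b)` entry is `(-1)^{c_{σ b}}` where `c_j = #{i : i < j, σ⁻¹ i > σ⁻¹ j}`. -/
theorem epipelagic_stmt2 (m : ℕ) (σ : Equiv.Perm (Fin (m + 2))) (l : List (Fin (m + 1)))
    (hword : σ = (l.map fun i => Equiv.swap i.castSucc i.succ).prod)
    (hreduced : l.length = (Finset.univ.filter fun p : Fin (m + 2) × Fin (m + 2) =>
      p.1 < p.2 ∧ σ⁻¹ p.2 < σ⁻¹ p.1).card) :
    (l.map (springerN m)).prod = Matrix.of fun a b =>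
      if a = σ b then
        (-1 : ℂ) ^ ((Finset.univ.filter fun i : Fin (m + 2) =>
          i < σ b ∧ σ⁻¹ (σ b) < σ⁻¹ i).card)
      else 0 := by
  change σ = wd l at hword
  subst hword
  rw [inv_eq_sum] at hreduced
  ext a b
  rw [main_aux m l hreduced, Matrix.of_apply]
  split_ifs with h
  · rw [h]; rfl
  · rfl
end

section
/- Let n ≥ 1 and let q be a unit of ℤ/nℤ. The sign of the permutation of ℤ/nℤ given by x ↦ q·x equals (−1)^k, where k is the number of orbits O of the cyclic group generated by this permutation such that O = −O (i.e. O is stable under negation) and O has even cardinality. -/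
open Equiv.Perm in
lemma aux_orbit {α : Type*} (f : Equiv.Perm α) (x : α) :
    MulAction.orbit (Subgroup.zpowers f) x = {y | SameCycle f x y} := by
  ext y
  simp only [MulAction.mem_orbit_iff, Set.mem_ofPred_eq, SameCycle]
  constructor
  · rintro ⟨⟨_, i, rfl⟩, h⟩
    exact ⟨i, h⟩
  · rintro ⟨i, h⟩
    exact ⟨⟨_, i, rfl⟩, h⟩

open Equiv.Perm in
lemma aux_support {α : Type*} [Fintype α] [DecidableEq α] (f : Equiv.Perm α) (x : α)
    (hx : x ∈ f.support) :
    ((f.cycleOf x).support : Set α) = MulAction.orbit (Subgroup.zpowers f) x := by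
  rw [aux_orbit]
  ext y
  simp only [Finset.mem_coe, mem_support_cycleOf_iff, Set.mem_ofPred_eq]
  exact ⟨fun h => h.1, fun h => ⟨h, hx⟩⟩

open Equiv.Perm in
open scoped Classical in
lemma aux_sign {α : Type*} [Fintype α] [DecidableEq α] (f : Equiv.Perm α) :
    sign f = ∏ O ∈ (Finset.univ : Finset (Set α)) with
      (∃ x, O = MulAction.orbit (Subgroup.zpowers f) x) ∧ Even (Nat.card O), (-1 : ℤˣ) := by
  have h1 : sign f = ∏ c ∈ f.cycleFactorsFinset, (-(-1 : ℤˣ) ^ c.support.card) := by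
    rw [sign_of_cycleType', cycleType_def, Multiset.map_map]
    rfl
  have h2 : sign f = ∏ c ∈ f.cycleFactorsFinset with Even c.support.card, (-1 : ℤˣ) := by
    rw [h1, Finset.prod_filter]
    refine Finset.prod_congr rfl fun c _ => ?_
    split_ifs with h
    · rw [h.neg_one_pow]
    · rw [(Nat.not_even_iff_odd.1 h).neg_one_pow, neg_neg]
  rw [h2]
  refine Finset.prod_bij (fun c _ => (c.support : Set α)) ?_ ?_ ?_ (fun _ _ => rfl)
  · intro c hc
    obtain ⟨hc, he⟩ := Finset.mem_filter.1 hc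
    refine Finset.mem_filter.2 ⟨Finset.mem_univ _, ?_, by rwa [Nat.card_coe_set_eq, Set.ncard_coe_finset]⟩
    obtain ⟨x, hx⟩ := (mem_cycleFactorsFinset_iff.1 hc).1.nonempty_support
    refine ⟨x, ?_⟩
    rw [← aux_support f x (mem_cycleFactorsFinset_support_le hc hx), ← cycle_is_cycleOf hx hc]
  · intro c hc d hd h
    obtain ⟨hc, -⟩ := Finset.mem_filter.1 hc
    obtain ⟨hd, -⟩ := Finset.mem_filter.1 hd
    have h' : c.support = d.support := by exact_mod_cast h
    obtain ⟨x, hx⟩ := (mem_cycleFactorsFinset_iff.1 hc).1.nonempty_support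
    rw [cycle_is_cycleOf hx hc, cycle_is_cycleOf (h' ▸ hx) hd]
  · intro O hO
    obtain ⟨-, ⟨x, rfl⟩, he⟩ := Finset.mem_filter.1 hO
    have hx : x ∈ f.support := by
      by_contra hx
      rw [notMem_support] at hx
      have : MulAction.orbit (Subgroup.zpowers f) x = {x} := by
        rw [aux_orbit]
        ext y
        simp only [Set.mem_ofPred_eq, Set.mem_singleton_iff]
        constructor
        · rintro ⟨i, hi⟩
          rw [zpow_apply_eq_self_of_apply_eq_self hx] at hi
          exact hi.symm
        · rintro rfl
          exact SameCycle.refl _ _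
      rw [this] at he
      simp at he
    refine ⟨f.cycleOf x, Finset.mem_filter.2 ⟨cycleOf_mem_cycleFactorsFinset_iff.2 hx, ?_⟩,
      aux_support f x hx⟩
    rw [← aux_support f x hx] at he
    rwa [Nat.card_coe_set_eq, Set.ncard_coe_finset] at he

lemma aux_neg (n : ℕ) (q : (ZMod n)ˣ) (x : ZMod n) :
    Neg.neg '' (MulAction.orbit
      (Subgroup.zpowers (MulAction.toPerm q : Equiv.Perm (ZMod n))) x) =
    MulAction.orbit (Subgroup.zpowers (MulAction.toPerm q : Equiv.Perm (ZMod n))) (-x) := by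
  have key : ∀ (i : ℤ) (y : ZMod n),
      ((MulAction.toPerm q : Equiv.Perm (ZMod n)) ^ i) y = (q ^ i) • y := by
    intro i y
    have := map_zpow (MulAction.toPermHom (ZMod n)ˣ (ZMod n)) q i
    exact (congrArg (fun g : Equiv.Perm (ZMod n) => g y) this).symm
  rw [aux_orbit, aux_orbit]
  ext y
  simp only [Set.mem_image, Set.mem_ofPred_eq, Equiv.Perm.SameCycle, key]
  constructor
  · rintro ⟨_, ⟨i, rfl⟩, rfl⟩
    exact ⟨i, smul_neg _ _⟩
  · rintro ⟨i, rfl⟩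
    exact ⟨_, ⟨i, rfl⟩, (smul_neg _ _).symm⟩

/-- For `n ≥ 1` and a unit `q` of `ℤ/nℤ`, the sign of the permutation `x ↦ q x` of `ℤ/nℤ`
equals `(-1)^k`, where `k` is the number of orbits `O` of the cyclic group generated by this
permutation which satisfy `O = -O` and have even cardinality. -/
theorem epipelagic_stmt3 (n : ℕ) [NeZero n] (q : (ZMod n)ˣ) :
    Equiv.Perm.sign (MulAction.toPerm q : Equiv.Perm (ZMod n)) =
      (-1) ^ Nat.card {O : Set (ZMod n) //
        (∃ x : ZMod n,
          O = MulAction.orbit (Subgroup.zpowers (MulAction.toPerm q : Equiv.Perm (ZMod n))) x) ∧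
        Neg.neg '' O = O ∧ Even (Nat.card O)} := by
  classical
  have hneg : ∀ O : Set (ZMod n), Neg.neg '' (Neg.neg '' O) = O := by
    intro O
    rw [Set.image_image]
    simp
  rw [aux_sign, ← Finset.prod_filter_mul_prod_filter_not _ (fun O => Neg.neg '' O = O)]
  rw [Finset.prod_involution (s := Finset.filter (fun O => ¬ Neg.neg '' O = O) _)
    (fun O _ => Neg.neg '' O), mul_one, Finset.prod_const, Nat.card_eq_fintype_card,
    Fintype.card_subtype, Finset.filter_filter]
  · congr 2
    ext O
    simp only [Finset.mem_filter]
    tauto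
  · intro O _
    simp
  · intro O hO _
    exact (Finset.mem_filter.1 hO).2
  · intro O hO
    obtain ⟨h, h3⟩ := Finset.mem_filter.1 hO
    obtain ⟨-, ⟨x, hx⟩, h2⟩ := Finset.mem_filter.1 h
    refine Finset.mem_filter.2 ⟨Finset.mem_filter.2 ⟨Finset.mem_univ _, ⟨-x, ?_⟩, ?_⟩, ?_⟩
    · rw [hx, aux_neg]
    · rwa [Nat.card_image_of_injective neg_injective]
    · rw [hneg]
      exact fun h => h3 h.symm
  · intro O _
    exact hneg O
end

section
/- Let n ≥ 1 and let q be a unit of ℤ/nℤ. Let X ⊆ ℤ/nℤ × ℤ/nℤ be the set of pairs (x,y) with x ≠ y, and let Γ be the subgroup of permutations of X generated by ŝ : (x,y) ↦ (x+1, y+1) and Q̂ : (x,y) ↦ (qx, qy). Then the map η : z ↦ (0,z) from (ℤ/nℤ)∖{0} to X meets each orbit of ŝ on X exactly once, and it induces a bijection from the set of orbits of multiplication by q on (ℤ/nℤ)∖{0} to the set of Γ-orbits on X. Moreover, under this bijection, the orbit of z under multiplication by q is stable under negation z ↦ −z if and only if the Γ-orbit of (0,z) is stable under the swap (x,y) ↦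 (y,x). -/
/-- The set `X` of pairs `(x, y)` in `ℤ/nℤ × ℤ/nℤ` with `x ≠ y`. -/
abbrev rootSet (n : ℕ) := {p : ZMod n × ZMod n // p.1 ≠ p.2}

/-- The permutation of `rootSet n` induced by `(x, y) ↦ (x + c, y + c)`. -/
def trX (n : ℕ) (c : ZMod n) : Equiv.Perm (rootSet n) :=
  Equiv.Perm.subtypePerm ((Equiv.addRight c).prodCongr (Equiv.addRight c)) (by intro p; simp)

/-- The permutation `ŝ : (x, y) ↦ (x + 1, y + 1)` of `rootSet n`. -/
def sHat (n : ℕ) : Equiv.Perm (rootSet n) := trX n 1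

/-- The permutation `Q̂ : (x, y) ↦ (q x, q y)` of `rootSet n`. -/
def qHat (n : ℕ) (q : (ZMod n)ˣ) : Equiv.Perm (rootSet n) :=
  Equiv.Perm.subtypePerm ((MulAction.toPerm q).prodCongr (MulAction.toPerm q)) (by
    intro p
    simp only [Equiv.prodCongr_apply, Prod.map, MulAction.toPerm_apply, ne_eq,
      smul_left_cancel_iff])

/-- The subgroup `Γ` of permutations of `rootSet n` generated by `ŝ` and `Q̂`. -/
def ΓHat (n : ℕ) (q : (ZMod n)ˣ) : Subgroup (Equiv.Perm (rootSet n)) :=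
  Subgroup.closure {sHat n, qHat n q}

/-- The point `η(z) = (0, z)` of `rootSet n`, for `z ≠ 0`. -/
def ηpt (n : ℕ) (z : ZMod n) (hz : z ≠ 0) : rootSet n := ⟨(0, z), fun h => hz h.symm⟩

/-- The nonzero residues `ℤ/nℤ ∖ {0}`. -/
abbrev nzRes (n : ℕ) := {z : ZMod n // z ≠ 0}

/-- Multiplication by the unit `q` as a permutation of the nonzero residues. -/
def μq (n : ℕ) (q : (ZMod n)ˣ) : Equiv.Perm (nzRes n) :=
  Equiv.Perm.subtypePerm (MulAction.toPerm q) (by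
    intro z
    simp only [MulAction.toPerm_apply, ne_eq, Units.smul_def, smul_eq_mul, Units.mul_right_eq_zero])

/-- Negation `z ↦ -z` on the nonzero residues. -/
def negNz (n : ℕ) : nzRes n → nzRes n := fun z => ⟨-z.1, by simpa using z.2⟩

/-- The swap `(x, y) ↦ (y, x)` on `rootSet n`. -/
def swapX (n : ℕ) : rootSet n → rootSet n := fun p => ⟨(p.1.2, p.1.1), fun h => p.2 h.symm⟩

/-- The difference `y - x` of a pair. -/
def dX (n : ℕ) (p : rootSet n) : nzRes n := ⟨p.1.2 - p.1.1, fun h => p.2 (sub_eq_zero.1 h).symm⟩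

theorem dX_eta (n : ℕ) (z : nzRes n) : dX n (ηpt n z.1 z.2) = z := by
  apply Subtype.ext
  simp [dX, ηpt]

theorem dX_surj (n : ℕ) : Function.Surjective (dX n) := fun z => ⟨_, dX_eta n z⟩

theorem dX_s (n : ℕ) (p : rootSet n) : dX n (sHat n p) = dX n p := by
  apply Subtype.ext
  simp [dX, sHat, trX]

theorem dX_q (n : ℕ) (q : (ZMod n)ˣ) (p : rootSet n) :
    dX n (qHat n q p) = μq n q (dX n p) := by
  apply Subtype.ext
  simp [dX, qHat, μq, smul_sub]

theorem dX_swap (n : ℕ) (p : rootSet n) : dX n (swapX n p) = negNz n (dX n p) := by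
  apply Subtype.ext
  simp [dX, swapX, negNz]

theorem sHat_pow (n : ℕ) (k : ℕ) (p : rootSet n) :
    ((sHat n ^ k) p).1 = (p.1.1 + k, p.1.2 + k) := by
  induction k with
  | zero => simp
  | succ k ih =>
    rw [pow_succ', Equiv.Perm.mul_apply]
    have h : ∀ r : rootSet n, (sHat n r).1 = (r.1.1 + 1, r.1.2 + 1) := fun r => rfl
    rw [h, ih]
    simp [add_assoc]

theorem dX_eq (n : ℕ) [NeZero n] (p r : rootSet n) (h : dX n r = dX n p) :
    ∃ k : ℕ, (sHat n ^ k) p = r := by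
  refine ⟨(r.1.1 - p.1.1).val, Subtype.ext ?_⟩
  have h' : r.1.2 - r.1.1 = p.1.2 - p.1.1 := congrArg Subtype.val h
  rw [sHat_pow, ZMod.natCast_zmod_val]
  ext
  · simp
  · linear_combination -h'

theorem perm_apply_inv {α : Type*} (f : Equiv.Perm α) (x : α) : f (f⁻¹ x) = x :=
  f.apply_symm_apply x

theorem sOrbit (n : ℕ) [NeZero n] (p r : rootSet n) :
    r ∈ MulAction.orbit (Subgroup.zpowers (sHat n)) p ↔ dX n r = dX n p := by
  constructor
  · rintro ⟨⟨g, hg⟩, rfl⟩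
    change dX n (g p) = dX n p
    rw [Subgroup.zpowers_eq_closure] at hg
    induction hg using Subgroup.closure_induction generalizing p with
    | mem x hx => rw [Set.mem_singleton_iff.1 hx, dX_s]
    | one => rfl
    | mul x y _ _ hx hy => rw [Equiv.Perm.mul_apply, hx, hy]
    | inv x _ hx =>
      have := hx (x⁻¹ p)
      rwa [perm_apply_inv, eq_comm] at this
  · intro h
    obtain ⟨k, hk⟩ := dX_eq n p r h
    exact ⟨⟨sHat n ^ k, Subgroup.npow_mem_zpowers _ _⟩, hk⟩

theorem dX_qz (n : ℕ) (q : (ZMod n)ˣ) (k : ℤ) (p : rootSet n) :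
    dX n ((qHat n q ^ k) p) = (μq n q ^ k) (dX n p) := by
  have hs : Function.Semiconj (dX n) (qHat n q) (μq n q) := dX_q n q
  induction k generalizing p with
  | zero => rfl
  | succ i ih => rw [zpow_add_one, zpow_add_one, Equiv.Perm.mul_apply, Equiv.Perm.mul_apply, ih, dX_q]
  | pred i ih =>
    rw [zpow_sub_one, zpow_sub_one, Equiv.Perm.mul_apply, Equiv.Perm.mul_apply, ih]
    congr 1
    rw [Equiv.Perm.eq_inv_iff_eq, ← dX_q, perm_apply_inv]

theorem gOrbit (n : ℕ) [NeZero n] (q : (ZMod n)ˣ) (p : rootSet n) :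
    MulAction.orbit (ΓHat n q) p =
      dX n ⁻¹' MulAction.orbit (Subgroup.zpowers (μq n q)) (dX n p) := by
  ext r
  rw [Set.mem_preimage]
  constructor
  · rintro ⟨⟨g, hg⟩, rfl⟩
    change dX n (g p) ∈ _
    unfold ΓHat at hg
    induction hg using Subgroup.closure_induction generalizing p with
    | mem x hx =>
      rcases hx with rfl | rfl
      · rw [dX_s]
        exact MulAction.mem_orbit_self _
      · rw [dX_q]
        exact ⟨⟨μq n q, Subgroup.mem_zpowers _⟩, rfl⟩
    | one => exact MulAction.mem_orbit_self _
    | mul x y _ _ hx hy =>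
      rw [Equiv.Perm.mul_apply, ← MulAction.orbit_eq_iff.2 (hy p)]
      exact hx _
    | inv x _ hx =>
      have := hx (x⁻¹ p)
      rwa [perm_apply_inv, MulAction.mem_orbit_symm] at this
  · rintro ⟨⟨g, k, rfl⟩, hg⟩
    change (μq n q ^ k) (dX n p) = dX n r at hg
    rw [← dX_qz] at hg
    obtain ⟨m, hm⟩ := dX_eq n _ r hg.symm
    refine ⟨⟨sHat n ^ m * qHat n q ^ k, ?_⟩, hm⟩
    exact mul_mem (pow_mem (Subgroup.subset_closure (by simp)) _)
      (zpow_mem (Subgroup.subset_closure (by simp)) _)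

theorem negNz_inv (n : ℕ) : Function.Involutive (negNz n) := fun z => by
  apply Subtype.ext
  simp [negNz]

theorem swapX_inv (n : ℕ) : Function.Involutive (swapX n) := fun _ => rfl

/-- For `n ≥ 1` and a unit `q` of `ℤ/nℤ`: the map `η : z ↦ (0, z)` meets each orbit of `ŝ`
on `X = rootSet n` exactly once; it induces a bijection from the orbits of multiplication by
`q` on `(ℤ/nℤ) ∖ {0}` to the `Γ`-orbits on `X`; and under this bijection the orbit of `z` is
stable under negation if and only if the `Γ`-orbit of `(0, z)` is stable under the swap
`(x, y) ↦ (y, x)`. -/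
theorem epipelagic_stmt4 (n : ℕ) [NeZero n] (q : (ZMod n)ˣ) :
    (∀ p : rootSet n, ∃! z : nzRes n,
      ηpt n z.1 z.2 ∈ MulAction.orbit (Subgroup.zpowers (sHat n)) p) ∧
    (∀ z w : nzRes n,
      MulAction.orbit (Subgroup.zpowers (μq n q)) z =
          MulAction.orbit (Subgroup.zpowers (μq n q)) w ↔
        MulAction.orbit (ΓHat n q) (ηpt n z.1 z.2) =
          MulAction.orbit (ΓHat n q) (ηpt n w.1 w.2)) ∧
    (∀ p : rootSet n, ∃ z : nzRes n, p ∈ MulAction.orbit (ΓHat n q) (ηpt n z.1 z.2)) ∧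
    (∀ z : nzRes n,
      negNz n '' MulAction.orbit (Subgroup.zpowers (μq n q)) z =
          MulAction.orbit (Subgroup.zpowers (μq n q)) z ↔
        swapX n '' MulAction.orbit (ΓHat n q) (ηpt n z.1 z.2) =
          MulAction.orbit (ΓHat n q) (ηpt n z.1 z.2)) := by
  refine ⟨fun p => ⟨dX n p, ?_, ?_⟩, ?_, ?_, ?_⟩
  · exact (sOrbit n _ _).2 (dX_eta n _)
  · intro z hz
    rwa [sOrbit, dX_eta] at hz
  · intro z w
    rw [gOrbit, gOrbit, dX_eta, dX_eta, (dX_surj n).preimage_injective.eq_iff]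
  · intro p
    refine ⟨dX n p, ?_⟩
    rw [gOrbit, dX_eta]
    exact MulAction.mem_orbit_self _
  · intro z
    rw [gOrbit, dX_eta, (swapX_inv n).image_eq_preimage_symm, (negNz_inv n).image_eq_preimage_symm,
      ← Set.preimage_comp, show dX n ∘ swapX n = negNz n ∘ dX n from funext (dX_swap n),
      Set.preimage_comp, (dX_surj n).preimage_injective.eq_iff]
end

section
/- Let ι be a finite type, neg : ι → ι an involution with neg(β) ≠ β for all β, and τ a permutation of ι commuting with neg. Let f : ι → ℤ satisfy f(neg β) = −f(β) and f(τ β) = −f(β) for all β, and let S ⊆ ι be a subset with neg(S) = S and τ(S) = S. Call a function p : ι → {±1} a gauge if p(neg β) = −p(β) for all β. For a gauge p, set ζ_p = Σ f(β), the sum taken over all β ∈ S with p(β) = 1 and p(τ⁻¹ β) = −1. Then for any two gauges p and q one has ζ_p ≡ ζ_q (mod 2). -/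
/-- Let `ι` be a finite type, `neg` a fixed-point-free involution of `ι`, `τ` a permutation
commuting with `neg`, `f : ι → ℤ` with `f (neg β) = -f β` and `f (τ β) = -f β`, and `S` a
subset stable under `neg` and `τ`.  For a gauge `p` (a `±1`-valued function with
`p (neg β) = -p β`), set `ζ_p = ∑_{β ∈ S, p β = 1, p (τ⁻¹ β) = -1} f β`.  Then for any two
gauges `p`, `q` one has `ζ_p ≡ ζ_q (mod 2)`. -/
theorem epipelagic_stmt5 (ι : Type*) [Fintype ι] [DecidableEq ι]
    (neg : ι → ι) (τ : Equiv.Perm ι) (f : ι → ℤ) (S : Finset ι) (p q : ι → ℤ)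
    (hneg_inv : ∀ β, neg (neg β) = β)
    (hneg_ne : ∀ β, neg β ≠ β)
    (hcomm : ∀ β, τ (neg β) = neg (τ β))
    (hf_neg : ∀ β, f (neg β) = -f β)
    (hf_tau : ∀ β, f (τ β) = -f β)
    (hS_neg : S.image neg = S)
    (hS_tau : S.image ⇑τ = S)
    (hp_val : ∀ β, p β = 1 ∨ p β = -1)
    (hp_gauge : ∀ β, p (neg β) = -p β)
    (hq_val : ∀ β, q β = 1 ∨ q β = -1)
    (hq_gauge : ∀ β, q (neg β) = -q β) :
    (∑ β ∈ S.filter fun β => p β = 1 ∧ p (τ⁻¹ β) = -1, f β) ≡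
      (∑ β ∈ S.filter fun β => q β = 1 ∧ q (τ⁻¹ β) = -1, f β) [ZMOD 2] := by
  have hSn : ∀ β, β ∈ S → neg β ∈ S := fun β hβ => by
    rw [← hS_neg]; exact Finset.mem_image_of_mem _ hβ
  have hSt : ∀ β, β ∈ S → τ β ∈ S := fun β hβ => by
    rw [← hS_tau]; exact Finset.mem_image_of_mem _ hβ
  have hSti : ∀ β, β ∈ S → τ⁻¹ β ∈ S := fun β hβ => by
    rw [← hS_tau] at hβ
    obtain ⟨a, ha, rfl⟩ := Finset.mem_image.1 hβ
    simpa using ha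
  have hcommi : ∀ β, τ⁻¹ (neg β) = neg (τ⁻¹ β) := fun β => by
    apply τ.injective
    rw [hcomm]; simp
  have sneg : ∀ g : ι → ℤ, ∑ β ∈ S, g (neg β) = ∑ β ∈ S, g β := fun g =>
    Finset.sum_nbij' neg neg hSn hSn (fun a _ => hneg_inv a) (fun a _ => hneg_inv a)
      (fun a _ => rfl)
  have stau : ∀ g : ι → ℤ, ∑ β ∈ S, g (τ⁻¹ β) = ∑ β ∈ S, g β := fun g =>
    Finset.sum_nbij' (fun β => τ⁻¹ β) (fun β => τ β) hSti hSt (fun a _ => by simp)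
      (fun a _ => by simp) (fun a _ => rfl)
  obtain ⟨h, hh⟩ : ∃ h : ι → ℤ, ∀ β, h β = f β % 2 := ⟨_, fun _ => rfl⟩
  have h_neg : ∀ β, h (neg β) = h β := fun β => by
    rw [hh, hh, hf_neg]; omega
  have h_tau : ∀ β, h (τ⁻¹ β) = h β := fun β => by
    have := hf_tau (τ⁻¹ β)
    rw [show τ (τ⁻¹ β) = β from τ.apply_symm_apply β] at this
    rw [hh, hh, this]; omega
  -- half of a sum over `S` of a `neg`-invariant function
  have half : ∀ g : ι → ℤ, (∀ β, g (neg β) = g β) →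
      ∑ β ∈ S, g β = 2 * ∑ β ∈ S, (if q β = 1 then g β else 0) := fun g hg => by
    rw [two_mul]
    nth_rewrite 1 [← sneg (fun β => if q β = 1 then g β else 0)]
    rw [← Finset.sum_add_distrib]
    refine Finset.sum_congr rfl fun β _ => ?_
    simp only [hq_gauge, hg]
    rcases hq_val β with e | e <;> simp [e]
  have zeta : ∀ r : ι → ℤ, (∀ β, r β = 1 ∨ r β = -1) → (∀ β, r (neg β) = -r β) →
      (∑ β ∈ S.filter fun β => r β = 1 ∧ r (τ⁻¹ β) = -1, f β) ≡
      ∑ β ∈ S, (if q β = 1 then (if r β = r (τ⁻¹ β) then 0 else h β) else 0) [ZMOD 2] := by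
    intro r hr hrg
    have h1 := half (fun β => if r β = r (τ⁻¹ β) then 0 else h β) (fun β => by
      simp only [hcommi, hrg, h_neg, neg_inj])
    have h2 : ∑ β ∈ S, (if r β = r (τ⁻¹ β) then 0 else h β) =
        2 * ∑ β ∈ S, (if r β = 1 ∧ r (τ⁻¹ β) = -1 then h β else 0) := by
      rw [two_mul]
      nth_rewrite 1 [← sneg (fun β => if r β = 1 ∧ r (τ⁻¹ β) = -1 then h β else 0)]
      rw [← Finset.sum_add_distrib]
      refine Finset.sum_congr rfl fun β _ => ?_
      simp only [hcommi, hrg, h_neg]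
      rcases hr β with e | e <;> rcases hr (τ⁻¹ β) with u | u <;> rw [e, u] <;> simp
    have h3 : ∑ β ∈ S, (if r β = 1 ∧ r (τ⁻¹ β) = -1 then h β else 0) =
        ∑ β ∈ S, (if q β = 1 then (if r β = r (τ⁻¹ β) then 0 else h β) else 0) := by
      linarith
    rw [← h3, Finset.sum_filter]
    refine Int.ModEq.sum fun β _ => ?_
    split_ifs
    · rw [hh]; exact (Int.mod_modEq _ _).symm
    · rfl
  refine (zeta p hp_val hp_gauge).trans (Int.ModEq.trans ?_ (zeta q hq_val hq_gauge).symm)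
  have e1 := half (fun β => if p β = q β then 0 else h β) (fun β => by
    simp only [hp_gauge, hq_gauge, h_neg, neg_inj])
  have e2 := half (fun β => if p (τ⁻¹ β) = q (τ⁻¹ β) then 0 else h (τ⁻¹ β)) (fun β => by
    simp only [hcommi, hp_gauge, hq_gauge, h_neg, neg_inj])
  have e3 := stau (fun β => if p β = q β then 0 else h β)
  simp only [h_tau] at e2 e3
  have key : ∑ β ∈ S, (if q β = 1 then (if p β = p (τ⁻¹ β) then 0 else h β) else 0) ≡
      ∑ β ∈ S, ((if q β = 1 then (if q β = q (τ⁻¹ β) then 0 else h β) else 0)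
        + ((if q β = 1 then (if p β = q β then 0 else h β) else 0)
        + (if q β = 1 then (if p (τ⁻¹ β) = q (τ⁻¹ β) then 0 else h β) else 0))) [ZMOD 2] := by
    refine Int.ModEq.sum fun β _ => ?_
    rcases hp_val β with a | a <;> rcases hp_val (τ⁻¹ β) with b | b <;>
      rcases hq_val β with c | c <;> rcases hq_val (τ⁻¹ β) with d | d <;>
      rw [a, b, c, d] <;> simp [Int.ModEq] <;> omega
  rw [Finset.sum_add_distrib, Finset.sum_add_distrib] at key
  refine key.trans ?_
  unfold Int.ModEq
  omega
end

section
/- Let E/F be a finite Galois extension of fields with Galois group Γ, and let κ : Γ → {±1} be a group homomorphism. Let v : Eˣ → ℤ satisfy v(xy) = v(x) + v(y) and v(σ(x)) = v(x) for all x, y ∈ Eˣ and σ ∈ Γ. Let z : Γ → Eˣ be a 1-cocycle for the κ-twisted action, i.e. z(στ) = z(σ) · σ(z(τ))^{κ(σ)} for all σ, τ ∈ Γ. Let c ∈ Eˣ and define the cohomologous cocycle z'(σ) = c⁻¹ · σ(c)^{κ(σ)} · z(σ). Then for any τ, τ' ∈ Γ with κ(τ) = κ(τ') = −1, one has (−1)^{v(z(τ))}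 = (−1)^{v(z'(τ'))}. In particular, the assignment z ↦ (−1)^{v(z(τ))} descends to a well-defined function on the first cohomology of Γ with coefficients in the κ-twisted module Eˣ, independent of the choice of τ with κ(τ) = −1. -/
/-- Let `E/F` be a finite Galois extension with Galois group `Γ = E ≃ₐ[F] E`, and
`κ : Γ → {±1}` a homomorphism.  Let `v : Eˣ → ℤ` be a Galois-invariant homomorphism, and
`z` a `1`-cocycle for the `κ`-twisted action of `Γ` on `Eˣ`, i.e.
`z (σ τ) = z σ ⬝ (σ (z τ))^{κ σ}`.  If `z'` is the cohomologous cocycle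
`z' σ = c⁻¹ ⬝ (σ c)^{κ σ} ⬝ z σ`, then for any `τ`, `τ'` with `κ τ = κ τ' = -1` one has
`(-1)^{v (z τ)} = (-1)^{v (z' τ')}`. -/
theorem epipelagic_stmt6 (F E : Type*) [Field F] [Field E] [Algebra F E]
    [FiniteDimensional F E] [IsGalois F E]
    (κ : (E ≃ₐ[F] E) →* ℤˣ)
    (v : Eˣ → ℤ)
    (hv_mul : ∀ x y : Eˣ, v (x * y) = v x + v y)
    (hv_gal : ∀ (σ : E ≃ₐ[F] E) (x : Eˣ), v (Units.map (σ : E →* E) x) = v x)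
    (z : (E ≃ₐ[F] E) → Eˣ)
    (hz : ∀ σ τ : E ≃ₐ[F] E,
      z (σ * τ) = z σ * (Units.map (σ : E →* E) (z τ)) ^ ((κ σ : ℤˣ) : ℤ))
    (c : Eˣ) (z' : (E ≃ₐ[F] E) → Eˣ)
    (hz' : ∀ σ : E ≃ₐ[F] E,
      z' σ = c⁻¹ * (Units.map (σ : E →* E) c) ^ ((κ σ : ℤˣ) : ℤ) * z σ)
    (τ τ' : E ≃ₐ[F] E) (hτ : κ τ = -1) (hτ' : κ τ' = -1) :
    (-1 : ℤˣ) ^ v (z τ) = (-1 : ℤˣ) ^ v (z' τ') := by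
  have hv_one : v 1 = 0 := by
    have := hv_mul 1 1
    rw [mul_one] at this
    omega
  have hv_inv : ∀ x : Eˣ, v x⁻¹ = - v x := by
    intro x
    have := hv_mul x x⁻¹
    rw [mul_inv_cancel, hv_one] at this
    omega
  have hpos : ∀ σ ρ : E ≃ₐ[F] E, κ σ = 1 → v (z (σ * ρ)) = v (z σ) + v (z ρ) := by
    intro σ ρ h
    rw [hz, hv_mul, h, Units.val_one, zpow_one, hv_gal]
  have hneg : ∀ σ ρ : E ≃ₐ[F] E, κ σ = -1 → v (z (σ * ρ)) = v (z σ) - v (z ρ) := by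
    intro σ ρ h
    rw [hz, hv_mul, h, Units.val_neg, Units.val_one, zpow_neg, zpow_one, hv_inv, hv_gal]
    ring
  have hone : v (z 1) = 0 := by
    have := hpos 1 1 (map_one κ)
    rw [mul_one] at this
    omega
  -- `v ∘ z` is a homomorphism from the finite group `ker κ` to `ℤ`, hence trivial
  have hker : ∀ σ : E ≃ₐ[F] E, κ σ = 1 → v (z σ) = 0 := by
    intro σ h
    have hp : ∀ n : ℕ, v (z (σ ^ n)) = n * v (z σ) := by
      intro n
      induction n with
      | zero => simp [hone]
      | succ k ih =>
        rw [pow_succ', hpos σ _ h, ih]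
        push_cast
        ring
    have h1 := hp (orderOf σ)
    rw [pow_orderOf_eq_one, hone] at h1
    have h2 : (orderOf σ : ℤ) ≠ 0 := by
      exact_mod_cast (orderOf_pos σ).ne'
    exact (mul_eq_zero.mp h1.symm).resolve_left h2
  have hττ : v (z τ') = v (z τ) := by
    have h1 := hneg τ (τ⁻¹ * τ') hτ
    rw [mul_inv_cancel_left, hker (τ⁻¹ * τ') (by rw [map_mul, map_inv, hτ, hτ']; simp)] at h1
    omega
  have hfin : v (z' τ') = v (z τ) + 2 * (- v c) := by
    rw [hz', hv_mul, hv_mul, hτ', Units.val_neg, Units.val_one, zpow_neg, zpow_one, hv_inv,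
      hv_inv, hv_gal, hττ]
    ring
  rw [hfin, zpow_add, zpow_mul]
  simp
end

section
/- Let Γ be a group acting ℤ-linearly on a ℤ-module M, let R ⊆ M be a finite Γ-stable subset with R = −R and β ≠ −β for all β ∈ R, and let λ : M → ℤ be a ℤ-linear map. Assume that Σ_{β∈O} λ(β) = 0 for every Γ-orbit O ⊆ R with O ∩ (−O) = ∅. Call a Γ-orbit O ⊆ R symmetric if O = −O; for each symmetric orbit O fix an element α_O ∈ O and a set X_O of representatives of the left cosets of Γ_{±α_O} = {σ : σ·α_O = ±α_O} in Γ. Then for every gauge p on R (a function p : R → {±1} with p(−β) = −p(β)), the congruence Σ_{β∈R, p(β)=1} λ(β) ≡ Σ_{O symmetric} Σ_{σ∈X_O} λ(σ·α_O) (mod 2) holds. -/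
/-- Two signed systems of representatives give the same sum mod 2. -/
lemma gauge_sum_aux {M ι : Type*} [AddCommGroup M] (l : M →+ ℤ) (p : M → ℤ)
    (A : Finset M) (I : Finset ι) (g : ι → M)
    (hA : ∀ β ∈ A, p β = 1) (hA' : ∀ β ∈ A, p (-β) = -1)
    (hval : ∀ i ∈ I, p (g i) = 1 ∨ p (g i) = -1)
    (hmem : ∀ i ∈ I, p (g i) = 1 → g i ∈ A)
    (hmem' : ∀ i ∈ I, p (g i) = -1 → -g i ∈ A)
    (hinj : ∀ i ∈ I, ∀ j ∈ I, (g i = g j ∨ g i = - g j) → i = j)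
    (hsurj : ∀ β ∈ A, ∃ i ∈ I, β = g i ∨ β = - g i) :
    (∑ β ∈ A, (l β : ZMod 2)) = ∑ i ∈ I, (l (g i) : ZMod 2) := by
  symm
  refine Finset.sum_bij (fun i _ => if p (g i) = 1 then g i else - g i) ?_ ?_ ?_ ?_
  · intro i hi
    rcases hval i hi with h | h
    · simpa [h] using hmem i hi h
    · simpa [h] using hmem' i hi h
  · intro i hi j hj h
    apply hinj i hi j hj
    split_ifs at h
    · exact Or.inl h
    · exact Or.inr h
    · right; rw [← h, neg_neg]
    · left; exact neg_injective h
  · intro β hβ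
    obtain ⟨i, hi, h | h⟩ := hsurj β hβ
    · refine ⟨i, hi, ?_⟩
      have := hA β hβ
      rw [h] at this
      simp [this, h]
    · refine ⟨i, hi, ?_⟩
      have := hA' β hβ
      rw [h, neg_neg] at this
      simp [this, h]
  · intro i hi
    split_ifs
    · rfl
    · rw [map_neg, Int.cast_neg, ZMod.neg_eq_self_mod_two]

/-- Let `Γ` act `ℤ`-linearly on a `ℤ`-module `M`, let `R ⊆ M` be a finite `Γ`-stable subset
with `R = -R` and `β ≠ -β` for all `β ∈ R`, and let `l : M → ℤ` be linear.  Assume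
`∑_{β ∈ O} l β = 0` for every `Γ`-orbit `O ⊆ R` with `O ∩ (-O) = ∅`.  Let `T` enumerate the
symmetric orbits (those with `O = -O`) by choosing one base point in each, and let `X α` be
a set of representatives of the left cosets of `Γ_{±α}` in `Γ` for each `α ∈ T`.  Then for
every gauge `p` on `R`:
`∑_{β ∈ R, p β = 1} l β ≡ ∑_{α ∈ T} ∑_{σ ∈ X α} l (σ • α)  (mod 2)`. -/
theorem epipelagic_stmt8 (Γ : Type*) [Group Γ] (M : Type*) [AddCommGroup M] [DecidableEq M]
    [DistribMulAction Γ M]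
    (R : Finset M) (l : M →+ ℤ)
    (hstab : ∀ (g : Γ), ∀ β ∈ R, g • β ∈ R)
    (hRneg : R.image (fun β => -β) = R)
    (hne : ∀ β ∈ R, β ≠ -β)
    (hasym : ∀ β ∈ R, MulAction.orbit Γ β ∩ (Neg.neg '' MulAction.orbit Γ β) = ∅ →
      ∑ᶠ γ ∈ MulAction.orbit Γ β, l γ = 0)
    (T : Finset M) (hTR : T ⊆ R)
    (hTsym : ∀ α ∈ T, Neg.neg '' MulAction.orbit Γ α = MulAction.orbit Γ α)
    (hTinj : ∀ α ∈ T, ∀ α' ∈ T, MulAction.orbit Γ α = MulAction.orbit Γ α' → α = α')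
    (hTsurj : ∀ β ∈ R, Neg.neg '' MulAction.orbit Γ β = MulAction.orbit Γ β →
      ∃ α ∈ T, MulAction.orbit Γ β = MulAction.orbit Γ α)
    (X : M → Set Γ)
    (hX : ∀ α ∈ T, ∀ γ : Γ, ∃! σ, σ ∈ X α ∧ (γ • α = σ • α ∨ γ • α = -(σ • α)))
    (p : M → ℤ)
    (hp_val : ∀ β ∈ R, p β = 1 ∨ p β = -1)
    (hp_gauge : ∀ β ∈ R, p (-β) = -p β) :
    (∑ β ∈ R.filter fun β => p β = 1, l β) ≡
      (∑ α ∈ T, ∑ᶠ σ ∈ X α, l (σ • α)) [ZMOD 2] := by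
  classical
  have hneg : ∀ β ∈ R, -β ∈ R := fun β hβ => by
    rw [← hRneg]; exact Finset.mem_image_of_mem _ hβ
  have horb : ∀ β ∈ R, ∀ γ ∈ MulAction.orbit Γ β, γ ∈ R := by
    rintro β hβ _ ⟨g, rfl⟩
    exact hstab g β hβ
  have hon : ∀ β γ : M, γ ∈ MulAction.orbit Γ β → -γ ∈ MulAction.orbit Γ (-β) := by
    rintro β _ ⟨g, rfl⟩
    exact ⟨g, smul_neg g β⟩
  have htr : ∀ a b c : M, a ∈ MulAction.orbit Γ b → b ∈ MulAction.orbit Γ c →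
      a ∈ MulAction.orbit Γ c := by
    intro a b c h1 h2
    rwa [← MulAction.orbit_eq_iff.mpr h2]
  have hsy : ∀ a b : M, a ∈ MulAction.orbit Γ b → b ∈ MulAction.orbit Γ a :=
    fun a b h => MulAction.mem_orbit_symm.mp h
  have hon' : ∀ β γ : M, -γ ∈ MulAction.orbit Γ β → γ ∈ MulAction.orbit Γ (-β) := by
    intro β γ h
    simpa using hon _ _ h
  have hsym1 : ∀ β : M, Neg.neg '' MulAction.orbit Γ β = MulAction.orbit Γ β ↔
      -β ∈ MulAction.orbit Γ β := by
    intro β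
    constructor
    · intro h
      rw [← h]
      exact ⟨β, MulAction.mem_orbit_self β, rfl⟩
    · intro h
      ext γ
      constructor
      · rintro ⟨δ, hδ, rfl⟩
        exact htr _ _ _ (hon _ _ hδ) h
      · intro hγ
        exact ⟨-γ, htr _ _ _ (hon _ _ hγ) h, neg_neg γ⟩
  have hasym1 : ∀ β : M, -β ∉ MulAction.orbit Γ β →
      MulAction.orbit Γ β ∩ (Neg.neg '' MulAction.orbit Γ β) = ∅ := by
    intro β h
    rw [Set.eq_empty_iff_forall_notMem]
    rintro _ ⟨h1, ⟨δ, hδ, rfl⟩⟩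
    exact h (htr _ _ _ (hsy _ _ (hon _ _ hδ)) h1)
  refine (ZMod.intCast_eq_intCast_iff _ _ 2).mp ?_
  push_cast
  set P := R.filter fun β => p β = 1 with hP
  have hPR : ∀ β ∈ P, β ∈ R := fun β h => (Finset.mem_filter.mp h).1
  have hP1 : ∀ β ∈ P, p β = 1 := fun β h => (Finset.mem_filter.mp h).2
  have hP2 : ∀ β ∈ P, p (-β) = -1 := fun β h => by rw [hp_gauge β (hPR β h), hP1 β h]
  have hPm : ∀ β ∈ R, p β = 1 → β ∈ P := fun β h h' => Finset.mem_filter.mpr ⟨h, h'⟩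
  have hPm' : ∀ β ∈ R, p β = -1 → -β ∈ P := fun β h h' =>
    Finset.mem_filter.mpr ⟨hneg β h, by rw [hp_gauge β h, h', neg_neg]⟩
  rw [← Finset.sum_filter_add_sum_filter_not P (fun β => -β ∈ MulAction.orbit Γ β)]
  have h0 : ∑ β ∈ P.filter (fun β => ¬ -β ∈ MulAction.orbit Γ β), (l β : ZMod 2) = 0 := by
    let K : M → Set M := fun β => {γ | γ ∈ MulAction.orbit Γ β ∨ -γ ∈ MulAction.orbit Γ β}
    have hK : ∀ β γ : M, K γ = K β ↔ γ ∈ K β := by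
      intro β γ
      constructor
      · intro h
        rw [← h]
        exact Or.inl (MulAction.mem_orbit_self γ)
      · have key : ∀ a b c : M, a ∈ K b → b ∈ K c → a ∈ K c := by
          rintro a b c (h1 | h1) (h2 | h2)
          · exact Or.inl (htr _ _ _ h1 h2)
          · exact Or.inr (htr _ _ _ (hon _ _ h1) h2)
          · exact Or.inr (htr _ _ _ h1 h2)
          · exact Or.inl (htr _ _ _ (hon' _ _ h1) h2)
        have ks : ∀ a b : M, a ∈ K b → b ∈ K a := by
          rintro a b (h | h)
          · exact Or.inl (hsy _ _ h)
          · exact Or.inr (by simpa using hon _ _ (hsy _ _ h))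
        intro h
        ext δ
        exact ⟨fun hd => key _ _ _ hd h, fun hd => key _ _ _ hd (ks _ _ h)⟩
    rw [← Finset.sum_fiberwise_of_maps_to (fun β hβ => Finset.mem_image_of_mem K hβ)]
    apply Finset.sum_eq_zero
    intro C hC
    obtain ⟨β, hβ, rfl⟩ := Finset.mem_image.mp hC
    obtain ⟨hβP, hβa⟩ := Finset.mem_filter.mp hβ
    have hβR := hPR β hβP
    have hz := hasym β hβR (hasym1 β hβa)
    have hset : MulAction.orbit Γ β = ((R.filter (fun γ => γ ∈ MulAction.orbit Γ β) : Finset M) : Set M) := by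
      ext γ
      simp only [Finset.coe_filter, Set.mem_setOf_eq]
      exact ⟨fun h => ⟨horb β hβR γ h, h⟩, fun h => h.2⟩
    rw [finsum_mem_eq_sum_of_inter_support_eq (t := R.filter (fun γ => γ ∈ MulAction.orbit Γ β)) _
      (by rw [← hset])] at hz
    have hz' := congrArg (Int.cast : ℤ → ZMod 2) hz
    push_cast at hz'
    rw [← hz']
    have hasK : ∀ γ ∈ K β, ¬ -γ ∈ MulAction.orbit Γ γ := by
      rintro γ (h | h) h2
      · exact hβa (htr _ _ _ (htr _ _ _ (hsy _ _ (hon _ _ h)) h2) h)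
      · have h3 : γ ∈ MulAction.orbit Γ (-γ) := hsy _ _ h2
        have h4 : γ ∈ MulAction.orbit Γ β := htr _ _ _ h3 h
        exact hβa (htr _ _ _ (hsy _ _ (hon _ _ h4)) h)
    refine gauge_sum_aux l p _ _ (fun γ => γ) ?_ ?_ ?_ ?_ ?_ ?_ ?_
    · intro γ hγ
      exact hP1 γ (Finset.mem_filter.mp (Finset.mem_filter.mp hγ).1).1
    · intro γ hγ
      exact hP2 γ (Finset.mem_filter.mp (Finset.mem_filter.mp hγ).1).1
    · intro γ hγ
      exact hp_val γ (Finset.mem_filter.mp hγ).1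
    · intro γ hγ h
      obtain ⟨h1, h2⟩ := Finset.mem_filter.mp hγ
      have h3 : γ ∈ K β := Or.inl h2
      exact Finset.mem_filter.mpr ⟨Finset.mem_filter.mpr ⟨hPm γ h1 h, hasK γ h3⟩, (hK _ _).mpr h3⟩
    · intro γ hγ h
      obtain ⟨h1, h2⟩ := Finset.mem_filter.mp hγ
      have h3 : -γ ∈ K β := Or.inr (by rwa [neg_neg])
      exact Finset.mem_filter.mpr
        ⟨Finset.mem_filter.mpr ⟨hPm' γ h1 h, hasK _ h3⟩, (hK _ _).mpr h3⟩
    · rintro γ hγ δ hδ (h | h)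
      · exact h
      · exfalso
        obtain ⟨-, h2⟩ := Finset.mem_filter.mp hγ
        obtain ⟨-, h3⟩ := Finset.mem_filter.mp hδ
        have h4 : -δ ∈ MulAction.orbit Γ β := h ▸ h2
        exact hasK δ (Or.inl h3) (htr _ _ _ h4 (hsy _ _ h3))
    · intro γ hγ
      obtain ⟨h1, h2⟩ := Finset.mem_filter.mp hγ
      have hγR := hPR γ (Finset.mem_filter.mp h1).1
      rcases (hK _ _).mp h2 with h | h
      · exact ⟨γ, Finset.mem_filter.mpr ⟨hγR, h⟩, Or.inl rfl⟩
      · exact ⟨-γ, Finset.mem_filter.mpr ⟨hneg γ hγR, h⟩, Or.inr (neg_neg γ).symm⟩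
  rw [h0, add_zero]
  have hdec : P.filter (fun β => -β ∈ MulAction.orbit Γ β) =
      T.biUnion (fun α => P.filter (fun β => β ∈ MulAction.orbit Γ α)) := by
    ext β
    simp only [Finset.mem_filter, Finset.mem_biUnion]
    constructor
    · rintro ⟨h1, h2⟩
      obtain ⟨α, hα, h⟩ := hTsurj β (hPR β h1) ((hsym1 β).mpr h2)
      exact ⟨α, hα, h1, h ▸ MulAction.mem_orbit_self β⟩
    · rintro ⟨α, hα, h1, h2⟩
      refine ⟨h1, ?_⟩
      rw [← hsym1, MulAction.orbit_eq_iff.mpr h2]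
      exact hTsym α hα
  rw [hdec, Finset.sum_biUnion]
  swap
  · intro α hα α' hα' hne'
    rw [Function.onFun, Finset.disjoint_left]
    intro β h1 h2
    apply hne'
    apply hTinj α hα α' hα'
    rw [← MulAction.orbit_eq_iff.mpr (Finset.mem_filter.mp h1).2,
      ← MulAction.orbit_eq_iff.mpr (Finset.mem_filter.mp h2).2]
  apply Finset.sum_congr rfl
  intro α hα
  have hαR := hTR hα
  have hαs := (hsym1 α).mp (hTsym α hα)
  have hXinj : ∀ σ ∈ X α, ∀ τ ∈ X α, (σ • α = τ • α ∨ σ • α = -(τ • α)) → σ = τ := by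
    intro σ hσ τ hτ h
    exact (hX α hα σ).unique ⟨hσ, Or.inl rfl⟩ ⟨hτ, h⟩
  have hfin : (X α).Finite := by
    apply Set.Finite.of_finite_image (f := fun σ => σ • α)
    · apply R.finite_toSet.subset
      rintro _ ⟨σ, -, rfl⟩
      exact hstab σ α hαR
    · intro σ hσ τ hτ h
      exact hXinj σ hσ τ hτ (Or.inl h)
  rw [finsum_mem_eq_finite_toFinset_sum _ hfin]
  push_cast
  refine gauge_sum_aux l p _ _ (fun σ : Γ => σ • α) ?_ ?_ ?_ ?_ ?_ ?_ ?_
  · intro γ hγ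
    exact hP1 γ (Finset.mem_filter.mp hγ).1
  · intro γ hγ
    exact hP2 γ (Finset.mem_filter.mp hγ).1
  · intro σ _
    exact hp_val _ (hstab σ α hαR)
  · intro σ _ h
    exact Finset.mem_filter.mpr ⟨hPm _ (hstab σ α hαR) h, ⟨σ, rfl⟩⟩
  · intro σ _ h
    exact Finset.mem_filter.mpr ⟨hPm' _ (hstab σ α hαR) h,
      htr _ _ _ (hon _ _ ⟨σ, rfl⟩) hαs⟩
  · intro σ hσ τ hτ h
    exact hXinj σ (hfin.mem_toFinset.mp hσ) τ (hfin.mem_toFinset.mp hτ) h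
  · intro γ hγ
    obtain ⟨g, rfl⟩ := (Finset.mem_filter.mp hγ).2
    obtain ⟨σ, ⟨h1, h2⟩, -⟩ := hX α hα g
    exact ⟨σ, hfin.mem_toFinset.mpr h1, h2⟩
end

section
/- Let n ≥ 1, let q be a unit of ℤ/nℤ, and let a ∈ ℤ/nℤ with a ≠ 0 and a ≠ −a. Suppose m is the smallest positive integer such that q^m·a ∈ {a, −a}, and that q^m·a = −a. Let ŝ and Q̂ denote the permutations of ℤ/nℤ × ℤ/nℤ given by (x,y) ↦ (x+1, y+1) and (x,y) ↦ (qx, qy), and let Γ be the subgroup they generate. Then: (i) the stabilizer in Γ of the point (0,a) is the cyclic subgroup generated by Q̂^{2m}; (ii) the stabilizer in Γ of the two-element set {(0,a), (a,0)} is the cyclic subgroup generated by ŝ^a ∘ Q̂^m, where ŝ^a denotes the translation (x,y) ↦ (x+a, y+a). -/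
/-- The point `(a, 0)` of `rootSet n`, the negative of the root `η(a) = (0, a)`. -/
def ηptNeg (n : ℕ) (a : ZMod n) (ha : a ≠ 0) : rootSet n := ⟨(a, 0), fun h => ha h⟩

open scoped Pointwise

theorem aux_trX (n : ℕ) (c : ZMod n) (p : rootSet n) :
    ((trX n c p : rootSet n) : ZMod n × ZMod n) = (p.1.1 + c, p.1.2 + c) := rfl

theorem aux_qHat (n : ℕ) (u : (ZMod n)ˣ) (p : rootSet n) :
    ((qHat n u p : rootSet n) : ZMod n × ZMod n) = ((u : ZMod n) * p.1.1, (u : ZMod n) * p.1.2) := rfl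

/-- `Q̂` as a homomorphism in the unit. -/
def auxHom (n : ℕ) : (ZMod n)ˣ →* Equiv.Perm (rootSet n) where
  toFun u := qHat n u
  map_one' := by
    ext p <;> simp [aux_qHat]
  map_mul' u v := by
    ext p <;> simp [aux_qHat, mul_assoc]

theorem aux_zpow (n : ℕ) (u : (ZMod n)ˣ) (k : ℤ) : qHat n u ^ k = qHat n (u ^ k) :=
  ((auxHom n).map_zpow u k).symm

theorem aux_pow (n : ℕ) (u : (ZMod n)ˣ) (k : ℕ) : qHat n u ^ k = qHat n (u ^ k) :=
  ((auxHom n).map_pow u k).symm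

theorem aux_mul (n : ℕ) (c d : ZMod n) (u v : (ZMod n)ˣ) :
    (trX n c * qHat n u) * (trX n d * qHat n v) = trX n (c + u * d) * qHat n (u * v) := by
  ext p <;> simp [aux_qHat, aux_trX] <;> ring

theorem aux_one (n : ℕ) : trX n 0 * qHat n 1 = 1 := by
  ext p <;> simp [aux_qHat, aux_trX]

theorem aux_normal (n : ℕ) (q : (ZMod n)ˣ) (g : Equiv.Perm (rootSet n)) (hg : g ∈ ΓHat n q) :
    ∃ (c : ZMod n) (k : ℤ), g = trX n c * qHat n (q ^ k) := by
  unfold ΓHat at hg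
  induction hg using Subgroup.closure_induction with
  | mem x hx =>
    rcases hx with rfl | rfl
    · refine ⟨1, 0, ?_⟩
      ext p <;> simp [aux_qHat, aux_trX, sHat]
    · refine ⟨0, 1, ?_⟩
      ext p <;> simp [aux_qHat, aux_trX]
  | one => exact ⟨0, 0, by rw [zpow_zero, aux_one]⟩
  | mul x y _ _ hx hy =>
    obtain ⟨c, k, rfl⟩ := hx
    obtain ⟨d, l, rfl⟩ := hy
    exact ⟨_, k + l, by rw [aux_mul, zpow_add]⟩
  | inv x _ hx =>
    obtain ⟨c, k, rfl⟩ := hx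
    refine ⟨-(((q ^ (-k) : (ZMod n)ˣ) : ZMod n) * c), -k, ?_⟩
    rw [inv_eq_iff_mul_eq_one, aux_mul, ← zpow_add, add_neg_cancel, zpow_zero, ← aux_one]
    congr 2
    rw [mul_neg, ← mul_assoc, ← Units.val_mul, ← zpow_add, add_neg_cancel, zpow_zero]
    simp

theorem aux_trX_mem (n : ℕ) [NeZero n] (q : (ZMod n)ˣ) (c : ZMod n) : trX n c ∈ ΓHat n q := by
  have h : ∀ k : ℕ, trX n (k : ZMod n) ∈ ΓHat n q := by
    intro k
    induction k with
    | zero =>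
      have : trX n ((0 : ℕ) : ZMod n) = 1 := by
        ext p <;> simp [aux_trX]
      rw [this]; exact one_mem _
    | succ k ih =>
      have : trX n ((k + 1 : ℕ) : ZMod n) = sHat n * trX n (k : ZMod n) := by
        ext p <;> simp [aux_trX, sHat] <;> ring
      rw [this]
      exact mul_mem (Subgroup.subset_closure (by simp)) ih
  have := h c.val
  rwa [ZMod.natCast_zmod_val] at this

theorem aux_qHat_mem (n : ℕ) (q : (ZMod n)ˣ) : qHat n q ∈ ΓHat n q :=
  Subgroup.subset_closure (by simp)

theorem aux_arith (n : ℕ) (q : (ZMod n)ˣ) (a : ZMod n) (hsym : a ≠ -a)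
    (m : ℕ) (hm : 0 < m)
    (hmin : ∀ t : ℕ, 0 < t → t < m →
      (q : ZMod n) ^ t * a ≠ a ∧ (q : ZMod n) ^ t * a ≠ -a)
    (hqm : (q : ZMod n) ^ m * a = -a) (k : ℤ) :
    (((q ^ k : (ZMod n)ˣ) : ZMod n) * a = a → ∃ j : ℤ, k = 2 * m * j) ∧
    (((q ^ k : (ZMod n)ˣ) : ZMod n) * a = -a → ∃ j : ℤ, k = m + 2 * m * j) := by
  have h1 : q ^ (m : ℤ) • a = -a := by
    rw [Units.smul_def, zpow_natCast, Units.val_pow_eq_pow_val, smul_eq_mul, hqm]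
  have h2 : q ^ (2 * m : ℤ) • a = a := by
    rw [two_mul, zpow_add, mul_smul, h1, smul_neg, h1, neg_neg]
  have h3 : ∀ j : ℤ, q ^ (2 * m * j : ℤ) • a = a := by
    intro j
    have : q ^ (2 * m : ℤ) ∈ MulAction.stabilizer (ZMod n)ˣ a := h2
    have := zpow_mem this j
    rwa [← zpow_mul] at this
  have hm' : (0 : ℤ) < m := by exact_mod_cast hm
  obtain ⟨r, hr⟩ : ∃ r, r = k % (2 * m : ℤ) := ⟨_, rfl⟩
  have hr0 : 0 ≤ r := hr ▸ Int.emod_nonneg _ (by omega)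
  have hr1 : r < 2 * m := hr ▸ Int.emod_lt_of_pos _ (by omega)
  have hk : k = r + 2 * m * (k / (2 * m)) := by rw [hr]; exact (Int.emod_add_mul_ediv _ _).symm
  have hkr : ((q ^ k : (ZMod n)ˣ) : ZMod n) * a = q ^ r • a := by
    rw [← smul_eq_mul, ← Units.smul_def]
    conv_lhs => rw [hk, zpow_add, mul_smul, h3]
  have hsm : ∀ t : ℤ, 0 < t → t < m → q ^ t • a ≠ a ∧ q ^ t • a ≠ -a := by
    intro t h0 h1
    lift t to ℕ using h0.le
    have := hmin t (by omega) (by omega)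
    rwa [Units.smul_def, zpow_natCast, Units.val_pow_eq_pow_val, smul_eq_mul]
  have hbig : ∀ t : ℤ, q ^ (t + m) • a = -(q ^ t • a) := by
    intro t
    rw [zpow_add, mul_smul, h1, smul_neg]
  rw [hkr]
  have hcase : r = 0 ∨ r = m ∨ (q ^ r • a ≠ a ∧ q ^ r • a ≠ -a) := by
    rcases lt_trichotomy r m with h | h | h
    · rcases hr0.eq_or_lt with h' | h'
      · exact Or.inl h'.symm
      · exact Or.inr (Or.inr (hsm r h' h))
    · exact Or.inr (Or.inl h)
    · right; right
      have e := hbig (r - m)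
      rw [sub_add_cancel] at e
      have := hsm (r - m) (by omega) (by omega)
      rw [e]
      exact ⟨fun h => this.2 (neg_eq_iff_eq_neg.mp h), fun h => this.1 (neg_injective h)⟩
  rcases hcase with h | h | h
  · rw [h, zpow_zero, one_smul]
    exact ⟨fun _ => ⟨_, by rw [h, zero_add] at hk; exact hk⟩, fun h => absurd h hsym⟩
  · rw [h, h1]
    exact ⟨fun h => absurd h.symm hsym, fun _ => ⟨_, by rw [h] at hk; exact hk⟩⟩
  · exact ⟨fun h' => absurd h' h.1, fun h' => absurd h' h.2⟩

/-- Let `a ∈ ℤ/nℤ` be nonzero with `a ≠ -a`, and let `m` be the smallest positive integer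
with `qᵐ a ∈ {a, -a}`; assume `qᵐ a = -a` (a symmetric non-singleton orbit).  Then the
stabilizer in `Γ = ⟨ŝ, Q̂⟩` of the point `(0, a)` is the cyclic subgroup generated by
`Q̂^(2m)`, and the stabilizer in `Γ` of the pair `{(0, a), (a, 0)}` is the cyclic subgroup
generated by `ŝ^a ∘ Q̂^m`. -/
theorem epipelagic_stmt10 (n : ℕ) [NeZero n] (q : (ZMod n)ˣ) (a : ZMod n)
    (ha : a ≠ 0) (hsym : a ≠ -a)
    (m : ℕ) (hm : 0 < m)
    (hmin : ∀ t : ℕ, 0 < t → t < m →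
      (q : ZMod n) ^ t * a ≠ a ∧ (q : ZMod n) ^ t * a ≠ -a)
    (hqm : (q : ZMod n) ^ m * a = -a) :
    {γ : Equiv.Perm (rootSet n) | γ ∈ ΓHat n q ∧ γ (ηpt n a ha) = ηpt n a ha} =
      ↑(Subgroup.zpowers ((qHat n q) ^ (2 * m))) ∧
    {γ : Equiv.Perm (rootSet n) | γ ∈ ΓHat n q ∧
        ⇑γ '' {ηpt n a ha, ηptNeg n a ha} = {ηpt n a ha, ηptNeg n a ha}} =
      ↑(Subgroup.zpowers (trX n a * (qHat n q) ^ m)) := by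
  have har := aux_arith n q a hsym m hm hmin hqm
  have hsq : (trX n a * qHat n q ^ m) ^ 2 = qHat n q ^ (2 * m) := by
    rw [aux_pow, aux_pow, pow_two, aux_mul, Units.val_pow_eq_pow_val, hqm, two_mul, pow_add]
    ext p <;> simp [aux_trX]
  have hz : ∀ j : ℤ, qHat n (q ^ (2 * m * j : ℤ)) = (qHat n q ^ (2 * m)) ^ j := by
    intro j
    rw [← aux_zpow, zpow_mul]
    norm_cast
  have ht0 : trX n 0 = 1 := by
    ext p <;> simp [aux_trX]
  have hg1 : (trX n a * qHat n q ^ m) (ηpt n a ha) = ηptNeg n a ha := by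
    rw [aux_pow]
    apply Subtype.ext
    simp [aux_trX, aux_qHat, ηpt, ηptNeg, hqm]
  have hg2 : (trX n a * qHat n q ^ m) (ηptNeg n a ha) = ηpt n a ha := by
    rw [aux_pow]
    apply Subtype.ext
    simp [aux_trX, aux_qHat, ηpt, ηptNeg, hqm]
  constructor
  · apply Set.Subset.antisymm
    · rintro γ ⟨hγ, hfix⟩
      obtain ⟨c, k, rfl⟩ := aux_normal n q γ hγ
      have h := congrArg Subtype.val hfix
      simp only [Equiv.Perm.mul_apply, aux_trX, aux_qHat, ηpt, Prod.mk.injEq, mul_zero,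
        zero_add] at h
      obtain ⟨rfl, h⟩ := h
      rw [add_zero] at h
      obtain ⟨j, rfl⟩ := (har k).1 h
      exact ⟨j, by simp only [ht0, one_mul, hz]⟩
    · have hle : Subgroup.zpowers (qHat n q ^ (2 * m)) ≤
          ΓHat n q ⊓ MulAction.stabilizer (Equiv.Perm (rootSet n)) (ηpt n a ha) := by
        rw [Subgroup.zpowers_le]
        refine ⟨pow_mem (aux_qHat_mem n q) _, ?_⟩
        rw [← hsq, pow_two]
        change (trX n a * qHat n q ^ m) ((trX n a * qHat n q ^ m) (ηpt n a ha)) = _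
        rw [hg1, hg2]
      intro γ hγ
      exact hle hγ
  · apply Set.Subset.antisymm
    · rintro γ ⟨hγ, hfix⟩
      obtain ⟨c, k, rfl⟩ := aux_normal n q γ hγ
      have hmem : (trX n c * qHat n (q ^ k)) (ηpt n a ha) ∈
          ({ηpt n a ha, ηptNeg n a ha} : Set (rootSet n)) := by
        rw [← hfix]
        exact Set.mem_image_of_mem _ (by simp)
      rcases hmem with h | h
      · have h := congrArg Subtype.val h
        simp only [Equiv.Perm.mul_apply, aux_trX, aux_qHat, ηpt, Prod.mk.injEq, mul_zero,
          zero_add] at h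
        obtain ⟨rfl, h⟩ := h
        rw [add_zero] at h
        obtain ⟨j, rfl⟩ := (har k).1 h
        rw [ht0, one_mul, hz, ← hsq]
        exact zpow_mem (pow_mem (Subgroup.mem_zpowers _) _) _
      · have h := congrArg Subtype.val h
        simp only [Equiv.Perm.mul_apply, aux_trX, aux_qHat, ηpt, ηptNeg, Prod.mk.injEq, mul_zero,
          zero_add] at h
        obtain ⟨rfl, h⟩ := h
        obtain ⟨j, rfl⟩ := (har k).2 (eq_neg_of_add_eq_zero_left h)
        rw [← aux_zpow, zpow_add, aux_zpow n q (2 * m * j), hz, ← hsq, zpow_natCast, ← mul_assoc]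
        exact mul_mem (Subgroup.mem_zpowers _)
          (zpow_mem (pow_mem (Subgroup.mem_zpowers _) _) _)
    · have hle : Subgroup.zpowers (trX n a * qHat n q ^ m) ≤
          ΓHat n q ⊓ MulAction.stabilizer (Equiv.Perm (rootSet n))
            ({ηpt n a ha, ηptNeg n a ha} : Set (rootSet n)) := by
        rw [Subgroup.zpowers_le]
        refine ⟨mul_mem (aux_trX_mem n q a) (pow_mem (aux_qHat_mem n q) _), ?_⟩
        change ⇑(trX n a * qHat n q ^ m) '' _ = _
        rw [Set.image_pair, hg1, hg2, Set.pair_comm]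
      intro γ hγ
      exact hle hγ
end
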